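/- arXiv:2406.18874 — 3 statements merged into one kernel-verified Lean document; each statement's English description precedes it below -/
import Mathlib

section
/- Let 𝒜 ⊆ U₂ be a nonempty connected open subset and let φ : 𝒜 → U₂ satisfy rank(U − V) ≤ 1 ⟹ rank(φ(U) − φ(V)) ≤ 1 for all U, V ∈ 𝒜. Let 𝒟 ⊆ 𝒜 be a nonempty open subset. If Ψ is an automorphism of U₂ with φ(U) = Ψ(U) for every U ∈ 𝒟, then φ(U) = Ψ(U) for every U ∈ 𝒜. -/
open Matrix
open scoped ComplexOrder

noncomputable section

/-- The space of `2×2` complex matrices. -/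
abbrev Mat2 : Type := Matrix (Fin 2) (Fin 2) ℂ

/-- The group of `2×2` complex unitary matrices. -/
abbrev U2 : Type := Matrix.unitaryGroup (Fin 2) ℂ

/-- Coherency for matrices: `A ∼ B` iff `rank (A − B) ≤ 1`. -/
def Coherent (A B : Mat2) : Prop := (A - B).rank ≤ 1

/-- Coherency for unitaries: `U ∼ V` iff `rank (U − V) ≤ 1`. -/
def CoherentU (U V : U2) : Prop := ((U : Mat2) - (V : Mat2)).rank ≤ 1

/-- The Cayley transform, as a matrix: `𝔠(A) = (A − iI)(A + iI)⁻¹`. -/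
def cayleyMat (A : Mat2) : Mat2 :=
  (A - Complex.I • (1 : Mat2)) * (A + Complex.I • (1 : Mat2))⁻¹

open Classical in
/-- The Cayley transform, landing in the unitary group.  For every hermitian `A` the matrix
`cayleyMat A` is unitary, so the junk value `1` is never used for the matrices considered here. -/
def cayley (A : Mat2) : U2 :=
  if h : cayleyMat A ∈ Matrix.unitaryGroup (Fin 2) ℂ then ⟨cayleyMat A, h⟩ else 1

/-- An automorphism of `U₂`: a bijection preserving coherency in both directions. -/
def IsAut (Φ : U2 → U2) : Prop :=
  Function.Bijective Φ ∧ ∀ U V : U2, CoherentU U V ↔ CoherentU (Φ U) (Φ V)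

/-- A line in `U₂`: a maximal subset all of whose elements are pairwise coherent. -/
def IsLine (ℓ : Set U2) : Prop :=
  (∀ U ∈ ℓ, ∀ V ∈ ℓ, CoherentU U V) ∧
  ∀ m : Set U2, ℓ ⊆ m → (∀ U ∈ m, ∀ V ∈ m, CoherentU U V) → m = ℓ

/-- The matrix interval `[A, B] = {X : A ≤ X ≤ B}` (in the Loewner order). -/
def matIcc (A B : Mat2) : Set Mat2 := {X | (X - A).PosSemidef ∧ (B - X).PosSemidef}

/-- Rank one projections: `P = P* = P²` of rank one. -/
def IsProj1 (P : Mat2) : Prop := P.IsHermitian ∧ P * P = P ∧ P.rank = 1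

open Filter Topology

theorem Matrix.rank_le_one_iff_det_eq_zero (M : Mat2) : M.rank ≤ 1 ↔ M.det = 0 := by
  constructor
  · intro h
    by_contra hdet
    have := rank_of_det_ne_zero hdet
    simp at this
    omega
  · intro h
    obtain ⟨v, hv, hMv⟩ := exists_mulVec_eq_zero_iff.2 h
    have hker : M.mulVecLin.ker ≠ ⊥ := fun hbot =>
      hv ((Submodule.eq_bot_iff _).1 hbot v (by simpa using hMv))
    have hpos := Submodule.one_le_finrank_iff.2 hker
    have hsum := M.mulVecLin.finrank_range_add_finrank_ker
    simp only [Module.finrank_fin_fun] at hsum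
    rw [Matrix.rank]
    omega

theorem coherentU_iff_det (U V : U2) : CoherentU U V ↔ ((U : Mat2) - (V : Mat2)).det = 0 :=
  Matrix.rank_le_one_iff_det_eq_zero _

theorem CoherentU.symm {U V : U2} (h : CoherentU U V) : CoherentU V U := by
  rw [coherentU_iff_det] at h ⊢
  rw [← neg_sub, det_neg, h, mul_zero]

theorem coherentU_one_right_iff_det (U : U2) : CoherentU U 1 ↔ ((U : Mat2) - 1).det = 0 :=
  coherentU_iff_det U 1

theorem coherentU_mul_left_iff (X U V : U2) : CoherentU (X * U) (X * V) ↔ CoherentU U V := by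
  simp only [coherentU_iff_det]
  have hX : (X : Mat2).det ≠ 0 := (UnitaryGroup.det_isUnit X).ne_zero
  rw [UnitaryGroup.mul_val, UnitaryGroup.mul_val, ← mul_sub, det_mul]
  simp [hX]

/-- The unitary (for `v ≠ 0` and `‖μ‖ = 1`) that scales `v` by `μ` and fixes its orthogonal
complement. -/
def axisScaling (v : Fin 2 → ℂ) (μ : ℂ) : Mat2 :=
  1 + ((μ - 1) / (star v ⬝ᵥ v)) • vecMulVec v (star v)

theorem star_dotProduct_self_eq (v : Fin 2 → ℂ) :
    star v ⬝ᵥ v = ((‖v 0‖ ^ 2 + ‖v 1‖ ^ 2 : ℝ) : ℂ) := by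
  simp [dotProduct, Fin.sum_univ_two, Complex.conj_mul']

theorem star_dotProduct_self_ne_zero {v : Fin 2 → ℂ} (hv : v ≠ 0) : star v ⬝ᵥ v ≠ 0 :=
  fun h => hv (dotProduct_star_self_eq_zero.1 h)

theorem axisScaling_mem_unitaryGroup {v : Fin 2 → ℂ} (hv : v ≠ 0) {μ : ℂ} (hμ : ‖μ‖ = 1) :
    axisScaling v μ ∈ unitaryGroup (Fin 2) ℂ := by
  have hn : star v ⬝ᵥ v ≠ 0 := star_dotProduct_self_ne_zero hv
  have hn' : star (star v ⬝ᵥ v) = star v ⬝ᵥ v := by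
    rw [star_dotProduct_self_eq]; simp
  have hμ' : μ * star μ = 1 := by
    simp [Complex.mul_conj', hμ]
  rw [mem_unitaryGroup_iff, axisScaling, star_eq_conjTranspose, conjTranspose_add,
    conjTranspose_one, conjTranspose_smul, conjTranspose_vecMulVec, star_star]
  rw [add_mul, mul_add, mul_add, smul_mul_smul_comm, vecMulVec_mul_vecMulVec]
  simp only [one_mul, mul_one, smul_smul, add_assoc, vecMulVec_smul, star_div₀, hn']
  rw [← add_smul, ← add_smul]
  convert add_zero (1 : Mat2)
  rw [smul_eq_zero]
  left
  field_simp
  simp only [star_sub, star_one]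
  linear_combination hμ'

theorem axisScaling_mulVec_self {v : Fin 2 → ℂ} (hv : v ≠ 0) (μ : ℂ) :
    axisScaling v μ *ᵥ v = μ • v := by
  have hn : star v ⬝ᵥ v ≠ 0 := star_dotProduct_self_ne_zero hv
  rw [axisScaling, add_mulVec, one_mulVec, smul_mulVec, vecMulVec_mulVec, op_smul_eq_smul,
    smul_smul, div_mul_cancel₀ _ hn, sub_smul, one_smul, add_sub_cancel]

theorem axisScaling_mulVec_of_orthogonal {v w : Fin 2 → ℂ} (h : star v ⬝ᵥ w = 0) (μ : ℂ) :
    axisScaling v μ *ᵥ w = w := by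
  rw [axisScaling, add_mulVec, one_mulVec, smul_mulVec, vecMulVec_mulVec]
  simp [h]

theorem det_sub_axisScaling {v : Fin 2 → ℂ} (hv : v ≠ 0) (μ : ℂ) (Y : Mat2) :
    (star v ⬝ᵥ v) * (Y - axisScaling v μ).det =
      (star v ⬝ᵥ v) * (Y - 1).det - (μ - 1) * (star v ⬝ᵥ (Y - 1).adjugate *ᵥ v) := by
  have hn : star v ⬝ᵥ v ≠ 0 := star_dotProduct_self_ne_zero hv
  have h : (μ - 1) / (star v ⬝ᵥ v) * (star v ⬝ᵥ v) = μ - 1 := div_mul_cancel₀ _ hn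
  rw [axisScaling]
  generalize (μ - 1) / (star v ⬝ᵥ v) = c at h
  rw [← h]
  simp [det_fin_two, adjugate_fin_two, dotProduct, mulVec, Fin.sum_univ_two, vecMulVec_apply]
  ring

theorem det_axisScaling_sub_one (v : Fin 2 → ℂ) (μ : ℂ) : (axisScaling v μ - 1).det = 0 := by
  rw [axisScaling, add_sub_cancel_left, det_smul, det_fin_two]
  simp only [vecMulVec_apply]
  ring

theorem norm_eigenvalue_eq_one {W : Mat2} (hW : W ∈ unitaryGroup (Fin 2) ℂ) {v : Fin 2 → ℂ}
    (hv : v ≠ 0) {μ : ℂ} (h : W *ᵥ v = μ • v) : ‖μ‖ = 1 := by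
  have hn : star v ⬝ᵥ v ≠ 0 := star_dotProduct_self_ne_zero hv
  have h1 : star (W *ᵥ v) ⬝ᵥ (W *ᵥ v) = star v ⬝ᵥ v := by
    rw [star_mulVec, ← dotProduct_mulVec, mulVec_mulVec, ← star_eq_conjTranspose,
      mem_unitaryGroup_iff'.1 hW, one_mulVec]
  rw [h, star_smul, smul_dotProduct, dotProduct_smul, smul_eq_mul, smul_eq_mul, ← mul_assoc] at h1
  have h2 : star μ * μ = 1 := mul_right_cancel₀ hn (h1.trans (one_mul _).symm)
  have h3 : ‖μ‖ ^ 2 = 1 := by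
    rw [Complex.star_def, Complex.conj_mul'] at h2
    exact_mod_cast h2
  nlinarith [norm_nonneg μ]

theorem exists_eq_axisScaling {W : Mat2} (hW : W ∈ unitaryGroup (Fin 2) ℂ)
    (h : (W - 1).det = 0) : ∃ v μ, v ≠ 0 ∧ ‖μ‖ = 1 ∧ W = axisScaling v μ := by
  obtain ⟨u, hu, hWu⟩ := exists_mulVec_eq_zero_iff.2 h
  rw [sub_mulVec, one_mulVec, sub_eq_zero] at hWu
  have hWu' : star W *ᵥ u = u := by
    conv_lhs => rw [← hWu]
    rw [mulVec_mulVec, mem_unitaryGroup_iff'.1 hW, one_mulVec]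
  set v : Fin 2 → ℂ := ![-star (u 1), star (u 0)] with hv_def
  have huu : star u ⬝ᵥ u ≠ 0 := star_dotProduct_self_ne_zero hu
  have hv : v ≠ 0 := by
    intro h0
    apply hu
    ext i
    have h00 := congrFun h0 0
    have h01 := congrFun h0 1
    fin_cases i <;> simp_all
  have hvu : star v ⬝ᵥ u = 0 := by
    simp [hv_def, dotProduct, Fin.sum_univ_two]
    ring
  have horth : star u ⬝ᵥ (W *ᵥ v) = 0 := by
    rw [dotProduct_mulVec, ← star_star W, star_eq_conjTranspose, ← star_mulVec, hWu']
    simp [hv_def, dotProduct, Fin.sum_univ_two]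
    ring
  have heig : W *ᵥ v = ((star v ⬝ᵥ (W *ᵥ v)) / (star u ⬝ᵥ u)) • v := by
    generalize W *ᵥ v = x at horth
    rw [dotProduct, Fin.sum_univ_two] at horth
    ext i
    rw [Pi.smul_apply, smul_eq_mul, div_mul_eq_mul_div, eq_div_iff huu]
    fin_cases i <;> simp [hv_def, dotProduct, Fin.sum_univ_two] at horth ⊢
    · linear_combination u 0 * horth
    · linear_combination u 1 * horth
  set μ := (star v ⬝ᵥ (W *ᵥ v)) / (star u ⬝ᵥ u)
  refine ⟨v, μ, hv, norm_eigenvalue_eq_one hW hv heig, ?_⟩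
  have hP : (W - axisScaling v μ) * (of ![u, v])ᵀ = 0 := by
    have h1 : (W - axisScaling v μ) *ᵥ u = 0 := by
      rw [sub_mulVec, hWu, axisScaling_mulVec_of_orthogonal hvu, sub_self]
    have h2 : (W - axisScaling v μ) *ᵥ v = 0 := by
      rw [sub_mulVec, heig, axisScaling_mulVec_self hv, sub_self]
    ext i j
    fin_cases j
    · exact congrFun h1 i
    · exact congrFun h2 i
  have hdet : (of ![u, v])ᵀ.det ≠ 0 := by
    convert huu using 1
    simp [det_fin_two, hv_def, dotProduct, Fin.sum_univ_two]
    ring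
  have hunit : IsUnit (of ![u, v])ᵀ := (isUnit_iff_isUnit_det _).2 hdet.isUnit
  exact sub_eq_zero.1 (hunit.mul_left_eq_zero.1 hP)

theorem continuousAt_axisScaling {v : Fin 2 → ℂ} (hv : v ≠ 0) (μ : ℂ) :
    ContinuousAt (fun p : (Fin 2 → ℂ) × ℂ => axisScaling p.1 p.2) (v, μ) := by
  have hn : star v ⬝ᵥ v ≠ 0 := star_dotProduct_self_ne_zero hv
  have hsq : Continuous fun p : (Fin 2 → ℂ) × ℂ => star p.1 ⬝ᵥ p.1 :=
    Continuous.dotProduct (by fun_prop) (by fun_prop)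
  have hvec : Continuous fun p : (Fin 2 → ℂ) × ℂ => vecMulVec p.1 (star p.1) :=
    Continuous.matrix_vecMulVec (by fun_prop) (by fun_prop)
  have hsub : Continuous fun p : (Fin 2 → ℂ) × ℂ => p.2 - 1 := by fun_prop
  exact continuousAt_const.add ((hsub.continuousAt.div hsq.continuousAt hn).smul hvec.continuousAt)

theorem eq_zero_of_eventually_star_dotProduct_mulVec_eq_zero {M : Mat2} {v₀ : Fin 2 → ℂ}
    (h : ∀ᶠ v in 𝓝 v₀, star v ⬝ᵥ M *ᵥ v = 0) : M = 0 := by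
  have hq : ∀ w : Fin 2 → ℂ, star w ⬝ᵥ M *ᵥ w = 0 := by
    intro w
    have hadd : Tendsto (fun r : ℝ => v₀ + (r : ℂ) • w) (𝓝 0) (𝓝 v₀) :=
      Continuous.tendsto' (by fun_prop) _ _ (by simp)
    have hsub : Tendsto (fun r : ℝ => v₀ - (r : ℂ) • w) (𝓝 0) (𝓝 v₀) :=
      Continuous.tendsto' (by fun_prop) _ _ (by simp)
    obtain ⟨r, ⟨h1, h2⟩, hr⟩ :=
      (((hadd.eventually h).and (hsub.eventually h)).filter_mono nhdsWithin_le_nhds |>.and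
        (self_mem_nhdsWithin : ({0}ᶜ : Set ℝ) ∈ 𝓝[≠] 0)).exists
    have h0 := h.self_of_nhds
    have hr' : (r : ℂ) ≠ 0 := by exact_mod_cast hr
    have hsum : 2 * (r : ℂ) ^ 2 * (star w ⬝ᵥ M *ᵥ w) = 0 := by
      simp only [star_add, star_sub, star_smul, mulVec_add, mulVec_sub, mulVec_smul,
        add_dotProduct, sub_dotProduct, dotProduct_add, dotProduct_sub, smul_dotProduct,
        dotProduct_smul, smul_eq_mul, Complex.star_def, Complex.conj_ofReal] at h1 h2
      linear_combination h1 + h2 - 2 * h0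
    simpa [hr'] using hsum
  have h0 := hq ![1, 0]
  have h1 := hq ![0, 1]
  have h2 := hq ![1, 1]
  have h3 := hq ![1, Complex.I]
  simp [dotProduct, mulVec, Fin.sum_univ_two] at h0 h1 h2 h3
  have h4 : M 0 1 + M 1 0 = 0 := by linear_combination h2 - h0 - h1
  have h5 : M 0 1 - M 1 0 = 0 := by
    linear_combination (-Complex.I) * (h3 - h0 - h1) +
      (M 0 1 - M 1 0 - Complex.I * M 1 1) * Complex.I_sq
  ext i j
  fin_cases i <;> fin_cases j <;> simp
  · exact h0
  · linear_combination (h4 + h5) / 2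
  · linear_combination (h4 - h5) / 2
  · exact h1

theorem exists_ne_norm_eq_one_of_eventually {μ : ℂ} (hμ : ‖μ‖ = 1) {p : ℂ → Prop}
    (h : ∀ᶠ z in 𝓝 μ, p z) : ∃ z, z ≠ μ ∧ ‖z‖ = 1 ∧ p z := by
  have hμ0 : μ ≠ 0 := by rintro rfl; simp at hμ
  have hden : ∀ r : ℝ, 1 - (r : ℂ) * Complex.I ≠ 0 := fun r h0 => by
    simpa using congrArg Complex.re h0
  have hcont : Tendsto (fun r : ℝ => μ * ((1 + r * Complex.I) / (1 - r * Complex.I)))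
      (𝓝 0) (𝓝 μ) :=
    (continuous_const.mul (Continuous.div (by fun_prop) (by fun_prop) hden)).tendsto' _ _ (by simp)
  obtain ⟨r, hpr, hr⟩ := ((hcont.eventually h).filter_mono nhdsWithin_le_nhds |>.and
    (self_mem_nhdsWithin : ({0}ᶜ : Set ℝ) ∈ 𝓝[≠] 0)).exists
  refine ⟨_, ?_, ?_, hpr⟩
  · intro heq
    rw [mul_eq_left₀ hμ0, div_eq_one_iff_eq (hden r)] at heq
    have him := congrArg Complex.im heq
    simp at him
    exact hr (by linarith : r = 0)
  · have hconj : 1 - (r : ℂ) * Complex.I = star (1 + (r : ℂ) * Complex.I) := by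
      simp [sub_eq_add_neg]
    have hne : ‖1 + (r : ℂ) * Complex.I‖ ≠ 0 := by
      rw [← norm_star, ← hconj]
      exact norm_ne_zero_iff.2 (hden r)
    rw [norm_mul, hμ, norm_div, hconj, norm_star, div_self hne, one_mul]

theorem eq_zero_of_adjugate_eq_zero {M : Mat2} (h : M.adjugate = 0) : M = 0 := by
  rw [adjugate_fin_two, ← Matrix.ext_iff] at h
  simp only [Fin.forall_fin_two] at h
  ext i j
  fin_cases i <;> fin_cases j <;> simp_all

theorem eq_one_of_forall_coherentU {D : Set U2} (hD : IsOpen D) {d : U2} (hd : d ∈ D)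
    (hd1 : CoherentU d 1) {Y : U2} (hY : ∀ Z ∈ D, CoherentU Z 1 → CoherentU Y Z) : Y = 1 := by
  obtain ⟨O, hO, rfl⟩ := isOpen_induced_iff.1 hD
  obtain ⟨v, μ, hv, hμ, hdv⟩ := exists_eq_axisScaling d.2 ((coherentU_one_right_iff_det _).1 hd1)
  have hmem : ∀ᶠ p : (Fin 2 → ℂ) × ℂ in 𝓝 (v, μ), axisScaling p.1 p.2 ∈ O :=
    (continuousAt_axisScaling hv μ).eventually (hO.mem_nhds (hdv ▸ hd : axisScaling v μ ∈ O))
  rw [nhds_prod_eq] at hmem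
  obtain ⟨pv, hpv, pμ, hpμ, hp⟩ := eventually_prod_iff.1 hmem
  obtain ⟨ν, hνμ, hν, hpν⟩ := exists_ne_norm_eq_one_of_eventually hμ hpμ
  have hdet : ∀ w ≠ 0, pv w → ∀ z, ‖z‖ = 1 → pμ z →
      (star w ⬝ᵥ w) * ((Y : Mat2) - 1).det -
        (z - 1) * (star w ⬝ᵥ ((Y : Mat2) - 1).adjugate *ᵥ w) = 0 := by
    intro w hw hpw z hz hpz
    let Z : U2 := ⟨axisScaling w z, axisScaling_mem_unitaryGroup hw hz⟩
    have hZ : CoherentU Y Z := hY Z (hp hpw hpz)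
      ((coherentU_one_right_iff_det Z).2 (det_axisScaling_sub_one w z))
    have hYZ : ((Y : Mat2) - axisScaling w z).det = 0 := (coherentU_iff_det Y Z).1 hZ
    rw [← det_sub_axisScaling hw, hYZ, mul_zero]
  have hadj : ((Y : Mat2) - 1).adjugate = 0 := by
    refine eq_zero_of_eventually_star_dotProduct_mulVec_eq_zero (v₀ := v) ?_
    filter_upwards [hpv, isOpen_ne.mem_nhds hv] with w hpw hw
    have h1 := hdet w hw hpw μ hμ hpμ.self_of_nhds
    have h2 := hdet w hw hpw ν hν hpν
    refine (mul_eq_zero.1 ?_).resolve_left (sub_ne_zero.2 hνμ)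
    linear_combination h1 - h2
  exact Subtype.ext (sub_eq_zero.1 (eq_zero_of_adjugate_eq_zero hadj))

theorem exists_coherentU_chain_to_one (W : U2) : ∃ Z : U2, CoherentU 1 Z ∧ CoherentU Z W ∧
    ∀ i j, ‖(Z : Mat2) i j - (1 : Mat2) i j‖ ≤ ∑ k, ∑ l, ‖(W : Mat2) k l - (1 : Mat2) k l‖ := by
  obtain ⟨μ, hμ⟩ := Module.End.exists_eigenvalue (Matrix.toLin' (W : Mat2))
  obtain ⟨v, hv⟩ := hμ.exists_hasEigenvector
  have hv0 : v ≠ 0 := hv.2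
  have hWv : (W : Mat2) *ᵥ v = μ • v := by simpa using hv.apply_eq_smul
  have hpos : 0 < ‖v 0‖ ^ 2 + ‖v 1‖ ^ 2 := by
    have := star_dotProduct_self_ne_zero hv0
    rw [star_dotProduct_self_eq] at this
    exact lt_of_le_of_ne (by positivity) (by exact_mod_cast this.symm)
  have hμ1 : ‖μ - 1‖ ≤ ∑ k, ∑ l, ‖(W : Mat2) k l - (1 : Mat2) k l‖ := by
    set A : Mat2 := (W : Mat2) - 1 with hA
    have hAv : A *ᵥ v = (μ - 1) • v := by rw [hA, sub_mulVec, hWv, one_mulVec, sub_smul, one_smul]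
    have hbound : ∀ i, ‖μ - 1‖ * ‖v i‖ ≤ ‖A i 0‖ * ‖v 0‖ + ‖A i 1‖ * ‖v 1‖ := by
      intro i
      have := congrFun hAv i
      rw [Pi.smul_apply, smul_eq_mul, mulVec, dotProduct, Fin.sum_univ_two] at this
      rw [← norm_mul, ← this, ← norm_mul, ← norm_mul]
      exact norm_add_le _ _
    have h0 := hbound 0
    have h1 := hbound 1
    have hsum : 0 < ‖v 0‖ + ‖v 1‖ := by
      by_contra hle
      have e0 : ‖v 0‖ = 0 := by linarith [norm_nonneg (v 0), norm_nonneg (v 1)]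
      have e1 : ‖v 1‖ = 0 := by linarith [norm_nonneg (v 0), norm_nonneg (v 1)]
      simp [e0, e1] at hpos
    change ‖μ - 1‖ ≤ ∑ k, ∑ l, ‖A k l‖
    refine le_of_mul_le_mul_right ?_ hsum
    simp only [Fin.sum_univ_two]
    have a1 := mul_nonneg (norm_nonneg (A 0 0)) (norm_nonneg (v 1))
    have a2 := mul_nonneg (norm_nonneg (A 0 1)) (norm_nonneg (v 0))
    have a3 := mul_nonneg (norm_nonneg (A 1 0)) (norm_nonneg (v 1))
    have a4 := mul_nonneg (norm_nonneg (A 1 1)) (norm_nonneg (v 0))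
    linarith
  refine ⟨⟨axisScaling v μ, axisScaling_mem_unitaryGroup hv0 (norm_eigenvalue_eq_one W.2 hv0 hWv)⟩,
    CoherentU.symm ((coherentU_one_right_iff_det _).2 (det_axisScaling_sub_one v μ)),
    (coherentU_iff_det _ _).2 (exists_mulVec_eq_zero_iff.1 ⟨v, hv0, ?_⟩), fun i j => ?_⟩
  · rw [sub_mulVec, axisScaling_mulVec_self hv0, hWv, sub_self]
  · refine le_trans ?_ hμ1
    change ‖axisScaling v μ i j - (1 : Mat2) i j‖ ≤ _
    rw [axisScaling, star_dotProduct_self_eq, Matrix.add_apply, add_sub_cancel_left,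
      Matrix.smul_apply, vecMulVec_apply, smul_eq_mul, norm_mul, norm_div, norm_mul, Pi.star_apply, norm_star,
      Complex.norm_of_nonneg hpos.le, div_mul_eq_mul_div, div_le_iff₀ hpos]
    refine mul_le_mul_of_nonneg_left ?_ (norm_nonneg _)
    fin_cases i <;> fin_cases j <;> simp <;>
      nlinarith [sq_nonneg (‖v 0‖ - ‖v 1‖), sq_nonneg ‖v 0‖, sq_nonneg ‖v 1‖]

theorem eventually_exists_coherentU_chain {X : U2} {N : Set U2} (hN : N ∈ 𝓝 X) :
    ∀ᶠ W in 𝓝 X, ∃ Z ∈ N, CoherentU X Z ∧ CoherentU Z W := by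
  choose Z h1Z hZW hbound using exists_coherentU_chain_to_one
  have hZ : Tendsto Z (𝓝 1) (𝓝 1) := by
    refine tendsto_subtype_rng.2 (tendsto_pi_nhds.2 fun i => ?_)
    rw [tendsto_pi_nhds]
    intro j
    rw [tendsto_iff_norm_sub_tendsto_zero]
    refine squeeze_zero (fun _ => norm_nonneg _) (fun W => hbound W i j) ?_
    have hcont : Continuous fun W : U2 => ∑ k, ∑ l, ‖(W : Mat2) k l - (1 : Mat2) k l‖ := by
      refine continuous_finsetSum _ fun k _ => continuous_finsetSum _ fun l _ => ?_
      exact ((continuous_subtype_val.matrix_elem k l).sub continuous_const).norm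
    exact hcont.tendsto' _ _ (by simp)
  have htrans : Tendsto (fun W => X * Z (X⁻¹ * W)) (𝓝 X) (𝓝 X) := by
    have hin : Tendsto (fun W => X⁻¹ * W) (𝓝 X) (𝓝 1) :=
      (continuous_const_mul X⁻¹).tendsto' _ _ (inv_mul_cancel X)
    have hout : Tendsto (fun W => X * W) (𝓝 1) (𝓝 X) :=
      (continuous_const_mul X).tendsto' _ _ (mul_one X)
    exact hout.comp (hZ.comp hin)
  filter_upwards [htrans hN] with W hW
  refine ⟨_, hW, ?_, ?_⟩
  · have := (coherentU_mul_left_iff X _ _).2 (h1Z (X⁻¹ * W))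
    rwa [mul_one] at this
  · have := (coherentU_mul_left_iff X _ _).2 (hZW (X⁻¹ * W))
    rwa [mul_inv_cancel_left] at this

theorem eq_of_forall_coherentU {D : Set U2} (hD : IsOpen D) {d X Y : U2} (hd : d ∈ D)
    (hdX : CoherentU d X) (hY : ∀ Z ∈ D, CoherentU Z X → CoherentU Y Z) : Y = X := by
  have hshift : ∀ Z, CoherentU (X * Z) X ↔ CoherentU Z 1 := fun Z => by
    simpa using coherentU_mul_left_iff X Z 1
  have h : X⁻¹ * Y = 1 := by
    refine eq_one_of_forall_coherentU (hD.preimage (continuous_const_mul X)) (d := X⁻¹ * d)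
      (by simpa using hd) ((hshift _).1 (by simpa using hdX)) fun Z hZ hZ1 => ?_
    have := hY _ hZ ((hshift Z).2 hZ1)
    rw [← coherentU_mul_left_iff X]
    simpa using this
  exact (inv_mul_eq_one.1 h).symm

theorem isOpen_setOf_exists_coherentU {D : Set U2} (hD : IsOpen D) :
    IsOpen {X : U2 | ∃ d ∈ D, CoherentU d X} := by
  rw [isOpen_iff_mem_nhds]
  rintro X ⟨d, hd, hdX⟩
  have hcont : Tendsto (fun W : U2 => W * (X⁻¹ * d)) (𝓝 X) (𝓝 d) :=
    (continuous_mul_const _).tendsto' _ _ (mul_inv_cancel_left X d)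
  filter_upwards [hcont (hD.mem_nhds hd)] with W hW
  refine ⟨_, hW, ?_⟩
  rw [← coherentU_mul_left_iff (X * W⁻¹)]
  simpa [mul_assoc] using hdX

/-- **Identity-type theorem.**  If a coherency preserver on a nonempty connected open subset of
`U₂` agrees with an automorphism on a nonempty open subset, it agrees with it everywhere. -/
theorem identity_type_theorem
    (𝒜 : Set U2) (hAopen : IsOpen 𝒜) (hAconn : IsConnected 𝒜)
    (φ : U2 → U2)
    (hφ : ∀ U ∈ 𝒜, ∀ V ∈ 𝒜, CoherentU U V → CoherentU (φ U) (φ V))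
    (𝒟 : Set U2) (hD : 𝒟 ⊆ 𝒜) (hDopen : IsOpen 𝒟) (hDne : 𝒟.Nonempty)
    (Ψ : U2 → U2) (hΨ : IsAut Ψ)
    (hagree : ∀ U ∈ 𝒟, φ U = Ψ U) :
    ∀ U ∈ 𝒜, φ U = Ψ U := by
  set E : Set U2 := interior {U | U ∈ 𝒜 ∧ φ U = Ψ U}
  have hEmem : ∀ U ∈ E, U ∈ 𝒜 ∧ φ U = Ψ U := 
    fun U hU => interior_subset (s := {U | U ∈ 𝒜 ∧ φ U = Ψ U}) hU
  have hDE : 𝒟 ⊆ E := interior_maximal (fun U hU => ⟨hD hU, hagree U hU⟩) hDopen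
  have hstep : ∀ d ∈ E, ∀ X ∈ 𝒜, CoherentU d X → X ∈ E := by
    intro d hd X hX hdX
    refine interior_maximal (s := {U | U ∈ 𝒜 ∧ φ U = Ψ U}) ?_
      (hAopen.inter (isOpen_setOf_exists_coherentU isOpen_interior)) ⟨hX, d, hd, hdX⟩
    rintro V ⟨hV, e, he, heV⟩
    refine ⟨hV, ?_⟩
    obtain ⟨Y, hY⟩ := hΨ.1.surjective (φ V)
    suffices Y = V by rw [← hY, this]
    refine eq_of_forall_coherentU isOpen_interior he heV fun Z hZ hZV => ?_
    have hZ' := hEmem Z hZ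
    rw [hΨ.2, hY, ← hZ'.2]
    exact (hφ Z hZ'.1 V hV hZV).symm
  have hsub : 𝒜 ⊆ E := by
    refine hAconn.isPreconnected.subset_of_closure_inter_subset isOpen_interior
      (hDne.mono fun U hU => ⟨hD hU, hDE hU⟩) ?_
    rintro X ⟨hXcl, hX⟩
    obtain ⟨W, ⟨Z, hZ, hXZ, hZW⟩, hW⟩ := (mem_closure_iff_frequently.1 hXcl).and_eventually
      (eventually_exists_coherentU_chain (hAopen.mem_nhds hX)) |>.exists.imp fun _ h => h.symm
    exact hstep Z (hstep W hW Z hZ hZW.symm) X hX hXZ.symm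
  exact fun U hU => (hEmem U (hsub hU)).2
end
end

section
/- Let A, B, C ∈ H₂ with A < B < C, and let φ : [A, C] → U₂ satisfy rank(X − Y) ≤ 1 ⟹ rank(φ(X) − φ(Y)) ≤ 1 for all X, Y ∈ [A, C]. If φ(X) = 𝔠(X) for every X ∈ [A, B], then φ(X) = 𝔠(X) for every X ∈ [A, C]. -/
open Matrix
open scoped ComplexOrder

noncomputable section

theorem Matrix.IsHermitian.isUnit_add_I {Y : Mat2} (hY : Y.IsHermitian) :
    IsUnit (Y + Complex.I • (1 : Mat2)) := by
  have hpos : (Yᴴ * Y + 1).PosDef :=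
    PosDef.posSemidef_add (posSemidef_conjTranspose_mul_self Y) PosDef.one
  have hfac : Yᴴ * Y + 1 = (Y - Complex.I • (1 : Mat2)) * (Y + Complex.I • (1 : Mat2)) := by
    rw [hY.eq]
    simp only [mul_add, sub_mul, smul_mul_assoc, mul_smul_comm, one_mul, mul_one, smul_sub,
      smul_smul, Complex.I_mul_I, neg_smul, one_smul]
    abel
  have hdet := hpos.det_pos.ne'
  rw [hfac, det_mul] at hdet
  rw [isUnit_iff_isUnit_det]
  exact (right_ne_zero_of_mul hdet).isUnit

theorem Matrix.IsHermitian.conjTranspose_add_I {Y : Mat2} (hY : Y.IsHermitian) :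
    (Y + Complex.I • (1 : Mat2))ᴴ = Y - Complex.I • (1 : Mat2) := by
  rw [conjTranspose_add, conjTranspose_smul, hY.eq, conjTranspose_one]
  simp [sub_eq_add_neg]

theorem Matrix.IsHermitian.conjTranspose_sub_I {Y : Mat2} (hY : Y.IsHermitian) :
    (Y - Complex.I • (1 : Mat2))ᴴ = Y + Complex.I • (1 : Mat2) := by
  rw [← hY.conjTranspose_add_I, conjTranspose_conjTranspose]

theorem cayleyMat_mul_add_I {Y : Mat2} (hY : Y.IsHermitian) :
    cayleyMat Y * (Y + Complex.I • (1 : Mat2)) = Y - Complex.I • (1 : Mat2) := by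
  rw [cayleyMat, mul_assoc, nonsing_inv_mul _ ((isUnit_iff_isUnit_det _).1 hY.isUnit_add_I), mul_one]

theorem cayleyMat_mem_unitaryGroup {Y : Mat2} (hY : Y.IsHermitian) :
    cayleyMat Y ∈ Matrix.unitaryGroup (Fin 2) ℂ := by
  rw [mem_unitaryGroup_iff', star_eq_conjTranspose]
  have hu := hY.isUnit_add_I
  have hu' : IsUnit (Y - Complex.I • (1 : Mat2)) := by
    rw [← hY.conjTranspose_add_I]
    exact hu.star
  have hV := cayleyMat_mul_add_I hY
  have hV' := congrArg conjTranspose hV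
  rw [conjTranspose_mul, hY.conjTranspose_add_I, hY.conjTranspose_sub_I] at hV'
  apply hu'.mul_left_cancel
  apply hu.mul_right_cancel
  calc _ = ((Y - Complex.I • (1 : Mat2)) * (cayleyMat Y)ᴴ)
          * (cayleyMat Y * (Y + Complex.I • (1 : Mat2))) := by simp only [mul_assoc]
    _ = _ := by
      rw [hV, hV']
      simp only [mul_add, add_mul, mul_sub, sub_mul, smul_mul_assoc, mul_smul_comm, one_mul, mul_one,
        smul_sub, smul_add]
      abel

theorem coe_cayley {Y : Mat2} (hY : Y.IsHermitian) : (cayley Y : Mat2) = cayleyMat Y := by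
  rw [cayley, dif_pos (cayleyMat_mem_unitaryGroup hY)]

theorem CoherentU.exists_mulVec_eq {U : U2} {Y : Mat2} (hY : Y.IsHermitian)
    (h : CoherentU U (cayley Y)) :
    ∃ k : Fin 2 → ℂ, k ≠ 0 ∧ (U : Mat2) *ᵥ ((Y + Complex.I • (1 : Mat2)) *ᵥ k) =
      (Y - Complex.I • (1 : Mat2)) *ᵥ k := by
  have hdet : (((U : Mat2) - cayleyMat Y) * (Y + Complex.I • (1 : Mat2))).det = 0 := by
    rw [det_mul]
    by_contra hne
    have hr := rank_of_isUnit ((U : Mat2) - cayleyMat Y)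
      ((isUnit_iff_isUnit_det _).2 (left_ne_zero_of_mul hne).isUnit)
    rw [CoherentU, coe_cayley hY, hr] at h
    simp at h
  obtain ⟨k, hk0, hk⟩ := exists_mulVec_eq_zero_iff.2 hdet
  refine ⟨k, hk0, ?_⟩
  rwa [sub_mul, cayleyMat_mul_add_I hY, sub_mulVec, sub_eq_zero, ← mulVec_mulVec] at hk

theorem star_dotProduct_sub_mulVec_eq_zero {U : U2} {Y Z : Mat2} (hY : Y.IsHermitian)
    {k l : Fin 2 → ℂ}
    (hk : (U : Mat2) *ᵥ ((Y + Complex.I • (1 : Mat2)) *ᵥ k) = (Y - Complex.I • (1 : Mat2)) *ᵥ k)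
    (hl : (U : Mat2) *ᵥ ((Z + Complex.I • (1 : Mat2)) *ᵥ l) = (Z - Complex.I • (1 : Mat2)) *ᵥ l) :
    star k ⬝ᵥ ((Y - Z) *ᵥ l) = 0 := by
  have hU : (U : Mat2)ᴴ * (U : Mat2) = 1 := mem_unitaryGroup_iff'.1 U.2
  have h : star ((Y + Complex.I • (1 : Mat2)) *ᵥ k) ⬝ᵥ ((Z + Complex.I • (1 : Mat2)) *ᵥ l) =
      star ((Y - Complex.I • (1 : Mat2)) *ᵥ k) ⬝ᵥ ((Z - Complex.I • (1 : Mat2)) *ᵥ l) := by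
    rw [← hk, ← hl, star_mulVec (U : Mat2), ← dotProduct_mulVec, mulVec_mulVec _ (U : Mat2)ᴴ, hU,
      one_mulVec]
  rw [star_mulVec, star_mulVec, hY.conjTranspose_add_I, hY.conjTranspose_sub_I,
    ← dotProduct_mulVec, ← dotProduct_mulVec, mulVec_mulVec, mulVec_mulVec, ← sub_eq_zero,
    ← dotProduct_sub, ← sub_mulVec] at h
  have hexp : (Y - Complex.I • (1 : Mat2)) * (Z + Complex.I • (1 : Mat2)) -
      (Y + Complex.I • (1 : Mat2)) * (Z - Complex.I • (1 : Mat2)) =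
      (2 * Complex.I) • (Y - Z) := by
    simp [mul_add, add_mul, mul_sub, sub_mul, two_mul, add_smul, smul_sub]
    abel
  rw [hexp, smul_mulVec, dotProduct_smul, smul_eq_mul] at h
  simpa using h

/-- The rank one hermitian matrix `p p*`. -/
abbrev rankOne (p : Fin 2 → ℂ) : Mat2 := vecMulVec p (star p)

theorem isHermitian_add_smul_rankOne {X : Mat2} (hX : X.IsHermitian) (t : ℝ) (p : Fin 2 → ℂ) :
    (X + (t : ℂ) • rankOne p).IsHermitian := by
  refine hX.add ?_
  rw [IsHermitian, conjTranspose_smul, (posSemidef_vecMulVec_self_star p).1.eq]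
  simp

theorem exists_orthogonal_mulVec_eq {U : U2} {X : Mat2} (hX : X.IsHermitian) {p : Fin 2 → ℂ}
    {t₁ t₂ : ℝ} (ht : t₁ ≠ t₂) (h₁ : CoherentU U (cayley (X + (t₁ : ℂ) • rankOne p)))
    (h₂ : CoherentU U (cayley (X + (t₂ : ℂ) • rankOne p))) :
    ∃ k : Fin 2 → ℂ, k ≠ 0 ∧ star p ⬝ᵥ k = 0 ∧
      (U : Mat2) *ᵥ ((X + Complex.I • (1 : Mat2)) *ᵥ k) = (X - Complex.I • (1 : Mat2)) *ᵥ k := by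
  have reduce : ∀ (t : ℝ) (k : Fin 2 → ℂ), star p ⬝ᵥ k = 0 →
      (U : Mat2) *ᵥ ((X + (t : ℂ) • rankOne p + Complex.I • (1 : Mat2)) *ᵥ k) =
        (X + (t : ℂ) • rankOne p - Complex.I • (1 : Mat2)) *ᵥ k →
      (U : Mat2) *ᵥ ((X + Complex.I • (1 : Mat2)) *ᵥ k) =
        (X - Complex.I • (1 : Mat2)) *ᵥ k := by
    intro t k hpk hk
    have hz : rankOne p *ᵥ k = 0 := by simp [rankOne, vecMulVec_mulVec, hpk]
    simpa only [add_mulVec, sub_mulVec, smul_mulVec (t : ℂ), hz, smul_zero, add_zero] using hk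
  obtain ⟨k, hk0, hk⟩ := h₁.exists_mulVec_eq (isHermitian_add_smul_rankOne hX t₁ p)
  obtain ⟨l, hl0, hl⟩ := h₂.exists_mulVec_eq (isHermitian_add_smul_rankOne hX t₂ p)
  have h := star_dotProduct_sub_mulVec_eq_zero (isHermitian_add_smul_rankOne hX t₁ p) hk hl
  have hc : (t₁ : ℂ) - t₂ ≠ 0 := sub_ne_zero.2 (by exact_mod_cast ht)
  rw [add_sub_add_left_eq_sub, ← sub_smul, smul_mulVec, vecMulVec_mulVec] at h
  have h' : (star k ⬝ᵥ p) * (star p ⬝ᵥ l) = 0 := by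
    rw [dotProduct_smul, dotProduct_smul, smul_eq_mul, MulOpposite.smul_eq_mul_unop] at h
    exact (mul_eq_zero.1 h).resolve_left hc
  rcases mul_eq_zero.1 h' with hkp | hpl
  · have hpk : star p ⬝ᵥ k = 0 := by
      rw [← star_star (star p ⬝ᵥ k), star_dotProduct, star_star, hkp, star_zero]
    exact ⟨k, hk0, hpk, reduce t₁ k hpk hk⟩
  · exact ⟨l, hl0, hpl, reduce t₂ l hpl hl⟩

/-- A unitary coherent to two points on each of two light lines through `X` is `𝔠(X)`. -/
theorem eq_cayley_of_coherentU {U : U2} {X : Mat2} (hX : X.IsHermitian) {p q : Fin 2 → ℂ}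
    (hpq : p 0 * q 1 - p 1 * q 0 ≠ 0) {t₁ t₂ s₁ s₂ : ℝ} (ht : t₁ ≠ t₂) (hs : s₁ ≠ s₂)
    (h₁ : CoherentU U (cayley (X + (t₁ : ℂ) • rankOne p)))
    (h₂ : CoherentU U (cayley (X + (t₂ : ℂ) • rankOne p)))
    (h₃ : CoherentU U (cayley (X + (s₁ : ℂ) • rankOne q)))
    (h₄ : CoherentU U (cayley (X + (s₂ : ℂ) • rankOne q))) :
    U = cayley X := by
  obtain ⟨k, hk0, hpk, hk⟩ := exists_orthogonal_mulVec_eq hX ht h₁ h₂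
  obtain ⟨l, hl0, hql, hl⟩ := exists_orthogonal_mulVec_eq hX hs h₃ h₄
  set G : Mat2 := (U : Mat2) * (X + Complex.I • (1 : Mat2)) - (X - Complex.I • (1 : Mat2)) with hG
  have hGk : G *ᵥ k = 0 := by rw [hG, sub_mulVec, ← mulVec_mulVec, hk, sub_self]
  have hGl : G *ᵥ l = 0 := by rw [hG, sub_mulVec, ← mulVec_mulVec, hl, sub_self]
  have hkl : k 0 * l 1 - k 1 * l 0 ≠ 0 := by
    intro hkl
    simp only [dotProduct, Fin.sum_univ_two, Pi.star_apply] at hpk hql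
    have hqk : star (q 0) * k 0 + star (q 1) * k 1 = 0 := by
      by_contra hne
      apply hl0
      ext i
      refine (mul_eq_zero.1 ?_).resolve_right hne
      fin_cases i
      · simp only [Fin.zero_eta]
        linear_combination k 0 * hql - star (q 1) * hkl
      · simp only [Fin.mk_one]
        linear_combination k 1 * hql + star (q 0) * hkl
    have hne : star (p 0) * star (q 1) - star (p 1) * star (q 0) ≠ 0 := by
      simpa using star_ne_zero.2 hpq
    apply hk0
    ext i
    refine (mul_eq_zero.1 ?_).resolve_right hne
    fin_cases i
    · simp only [Fin.zero_eta]
      linear_combination star (q 1) * hpk - star (p 1) * hqk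
    · simp only [Fin.mk_one]
      linear_combination star (p 0) * hqk - star (q 0) * hpk
  have hG0 : G = 0 := by
    have e : G * !![k 0, l 0; k 1, l 1] = 0 := by
      ext i j
      have hki := congrFun hGk i
      have hli := congrFun hGl i
      simp only [mulVec, dotProduct, Fin.sum_univ_two, Pi.zero_apply] at hki hli
      fin_cases j <;> simp [mul_apply, Fin.sum_univ_two, hki, hli]
    have hu : IsUnit (!![k 0, l 0; k 1, l 1] : Mat2) := by
      rw [isUnit_iff_isUnit_det, det_fin_two_of, isUnit_iff_ne_zero]
      rwa [mul_comm (l 0)]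
    exact hu.mul_left_eq_zero.1 e
  apply Subtype.ext
  rw [coe_cayley hX]
  apply hX.isUnit_add_I.mul_right_cancel
  rw [cayleyMat_mul_add_I hX]
  exact sub_eq_zero.1 hG0

theorem Matrix.IsHermitian.exists_eq_mul_diagonal_mul {H : Mat2} (hH : H.IsHermitian) :
    ∃ (F : Mat2) (d : Fin 2 → ℝ), F.det ≠ 0 ∧ F * Fᴴ = 1 ∧
      H = F * diagonal (fun i => (d i : ℂ)) * Fᴴ := by
  have hu : (hH.eigenvectorUnitary : Mat2) * (hH.eigenvectorUnitary : Mat2)ᴴ = 1 :=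
    mem_unitaryGroup_iff.1 hH.eigenvectorUnitary.2
  refine ⟨hH.eigenvectorUnitary, hH.eigenvalues, fun h0 => ?_, hu, ?_⟩
  · have := congrArg det hu
    simp [h0] at this
  · conv_lhs => rw [hH.spectral_theorem, Unitary.conjStarAlgAut_apply]
    rfl

/-- Simultaneous diagonalization by congruence of a positive definite and a hermitian matrix. -/
theorem exists_simultaneous_diagonalization {H K : Mat2} (hH : H.PosDef) (hK : K.IsHermitian) :
    ∃ (F : Mat2) (x y : ℝ), F.det ≠ 0 ∧ y ≤ x ∧ H = F * Fᴴ ∧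
      K = F * !![(x : ℂ), 0; 0, (y : ℂ)] * Fᴴ := by
  obtain ⟨V, e, hVdet, hV, hHe⟩ := hH.isHermitian.exists_eq_mul_diagonal_mul
  have hVu : IsUnit V := (isUnit_iff_isUnit_det _).2 hVdet.isUnit
  have he : ∀ i, 0 < e i := by
    rw [hHe] at hH
    have := (IsUnit.posDef_star_right_conjugate_iff hVu).1 hH
    simpa using posDef_diagonal_iff.1 this
  obtain ⟨R, hRdet, hR⟩ : ∃ R : Mat2, R.det ≠ 0 ∧ H = R * Rᴴ := by
    refine ⟨V * diagonal (fun i => (√(e i) : ℂ)), ?_, ?_⟩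
    · rw [det_mul, det_diagonal]
      refine mul_ne_zero hVdet (Finset.prod_ne_zero_iff.2 fun i _ => ?_)
      exact_mod_cast (Real.sqrt_pos.2 (he i)).ne'
    · have hsq : diagonal (fun i => (√(e i) : ℂ)) * (diagonal (fun i => (√(e i) : ℂ)))ᴴ =
          diagonal (fun i => (e i : ℂ)) := by
        rw [diagonal_conjTranspose, diagonal_mul_diagonal]
        congr 1
        ext i
        simp only [Pi.star_apply, RCLike.star_def, Complex.conj_ofReal]
        exact_mod_cast Real.mul_self_sqrt (he i).le
      rw [conjTranspose_mul, ← mul_assoc, mul_assoc V, hsq, ← hHe]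
  have hRu : IsUnit R.det := hRdet.isUnit
  have hK' : (R⁻¹ * K * R⁻¹ᴴ).IsHermitian := isHermitian_mul_mul_conjTranspose _ hK
  obtain ⟨W, d, hWdet, hW, hKd⟩ := hK'.exists_eq_mul_diagonal_mul
  have hinv : R⁻¹ᴴ * Rᴴ = 1 := by
    rw [← conjTranspose_mul, mul_nonsing_inv _ hRu, conjTranspose_one]
  have hKR : K = R * W * diagonal (fun i => (d i : ℂ)) * (R * W)ᴴ := by
    calc K = (R * R⁻¹) * K * (R⁻¹ᴴ * Rᴴ) := by
          rw [mul_nonsing_inv _ hRu, hinv, one_mul, mul_one]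
      _ = R * (R⁻¹ * K * R⁻¹ᴴ) * Rᴴ := by simp only [mul_assoc]
      _ = _ := by rw [hKd, conjTranspose_mul]; simp only [mul_assoc]
  have hHR : H = (R * W) * (R * W)ᴴ := by
    rw [conjTranspose_mul, ← mul_assoc, mul_assoc R, hW, mul_one, hR]
  have hRW : (R * W).det ≠ 0 := by rw [det_mul]; exact mul_ne_zero hRdet hWdet
  have hdiag : diagonal (fun i => (d i : ℂ)) = !![(d 0 : ℂ), 0; 0, (d 1 : ℂ)] := by
    ext i j
    fin_cases i <;> fin_cases j <;> simp
  rcases le_total (d 1) (d 0) with h | h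
  · exact ⟨R * W, d 0, d 1, hRW, h, hHR, hdiag ▸ hKR⟩
  · set P : Mat2 := !![0, 1; 1, 0] with hP
    have hPH : Pᴴ = P := by
      ext i j
      fin_cases i <;> fin_cases j <;> simp [hP]
    have hPP : P * Pᴴ = 1 := by
      rw [hPH, hP]
      ext i j
      fin_cases i <;> fin_cases j <;> simp
    have hPd : P * !![(d 1 : ℂ), 0; 0, (d 0 : ℂ)] * Pᴴ = diagonal (fun i => (d i : ℂ)) := by
      rw [hPH, hdiag, hP]
      simp
    refine ⟨R * W * P, d 1, d 0, ?_, h, ?_, ?_⟩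
    · rw [det_mul]
      exact mul_ne_zero hRW (by simp [hP])
    · rw [conjTranspose_mul, ← mul_assoc, mul_assoc (R * W), hPP, mul_one, hHR]
    · calc K = R * W * (P * !![(d 1 : ℂ), 0; 0, (d 0 : ℂ)] * Pᴴ) * (R * W)ᴴ := by rw [hPd, ← hKR]
        _ = _ := by rw [conjTranspose_mul _ P]; simp only [mul_assoc]

theorem posSemidef_of_real_entries {a b d : ℝ} (ha : 0 ≤ a) (hd : 0 ≤ d) (h : b ^ 2 ≤ a * d) :
    (!![(a : ℂ), (b : ℂ); (b : ℂ), (d : ℂ)] : Mat2).PosSemidef := by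
  rcases ha.eq_or_lt with rfl | ha
  · have hb : b = 0 := by nlinarith
    subst hb
    have : (!![((0 : ℝ) : ℂ), ((0 : ℝ) : ℂ); ((0 : ℝ) : ℂ), (d : ℂ)] : Mat2) =
        diagonal ![0, (d : ℂ)] := by
      ext i j
      fin_cases i <;> fin_cases j <;> simp
    rw [this, posSemidef_diagonal_iff]
    intro i
    fin_cases i <;> simp [hd]
  · have ha' : (a : ℂ) ≠ 0 := by exact_mod_cast ha.ne'
    have hsplit : (!![(a : ℂ), (b : ℂ); (b : ℂ), (d : ℂ)] : Mat2) =
        ((1 / a : ℝ) : ℂ) • rankOne ![(a : ℂ), (b : ℂ)] +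
          diagonal ![0, ((d - b ^ 2 / a : ℝ) : ℂ)] := by
      ext i j
      rw [Matrix.add_apply, Matrix.smul_apply, rankOne, vecMulVec_apply]
      fin_cases i <;> fin_cases j <;> simp <;> field_simp
      ring
    have hda : 0 ≤ d - b ^ 2 / a := by
      rw [sub_nonneg, div_le_iff₀ ha]
      linarith
    rw [hsplit]
    refine ((posSemidef_vecMulVec_self_star _).smul ?_).add (posSemidef_diagonal_iff.2 fun i => ?_)
    · exact Complex.zero_le_real.2 (by positivity)
    · fin_cases i
      · simp
      · simpa only [Fin.mk_one, cons_val_one, cons_val_fin_one, Complex.zero_le_real] using hda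

/-- `S` contains every point of `[A, C]` which lies on two different light lines, each of which
contains two points of `S`. -/
def LightClosed (A C : Mat2) (S : Set Mat2) : Prop :=
  ∀ X ∈ matIcc A C, ∀ p q : Fin 2 → ℂ, p 0 * q 1 - p 1 * q 0 ≠ 0 →
    ∀ t₁ t₂ s₁ s₂ : ℝ, t₁ ≠ t₂ → s₁ ≠ s₂ →
      X + (t₁ : ℂ) • rankOne p ∈ S → X + (t₂ : ℂ) • rankOne p ∈ S →
      X + (s₁ : ℂ) • rankOne q ∈ S → X + (s₂ : ℂ) • rankOne q ∈ S → X ∈ S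

theorem mul_smul_rankOne_mul (F : Mat2) (t : ℂ) (p : Fin 2 → ℂ) :
    F * (t • rankOne p) * Fᴴ = t • rankOne (F *ᵥ p) := by
  rw [mul_smul_comm, smul_mul_assoc, rankOne, rankOne, star_mulVec, mul_vecMulVec, vecMulVec_mul]

theorem LightClosed.mem_congr {A C F M : Mat2} {S : Set Mat2} (hS : LightClosed A C S)
    (hF : F.det ≠ 0) (hX : A + F * M * Fᴴ ∈ matIcc A C) (p q : Fin 2 → ℂ)
    (hpq : p 0 * q 1 - p 1 * q 0 ≠ 0) {t₁ t₂ s₁ s₂ : ℝ} (ht : t₁ ≠ t₂) (hs : s₁ ≠ s₂)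
    (h₁ : A + F * (M + (t₁ : ℂ) • rankOne p) * Fᴴ ∈ S)
    (h₂ : A + F * (M + (t₂ : ℂ) • rankOne p) * Fᴴ ∈ S)
    (h₃ : A + F * (M + (s₁ : ℂ) • rankOne q) * Fᴴ ∈ S)
    (h₄ : A + F * (M + (s₂ : ℂ) • rankOne q) * Fᴴ ∈ S) :
    A + F * M * Fᴴ ∈ S := by
  simp only [mul_add, add_mul, mul_smul_rankOne_mul, ← add_assoc] at h₁ h₂ h₃ h₄
  refine hS _ hX (F *ᵥ p) (F *ᵥ q) ?_ t₁ t₂ s₁ s₂ ht hs h₁ h₂ h₃ h₄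
  have : (F *ᵥ p) 0 * (F *ᵥ q) 1 - (F *ᵥ p) 1 * (F *ᵥ q) 0 =
      F.det * (p 0 * q 1 - p 1 * q 0) := by
    simp only [mulVec, dotProduct, Fin.sum_univ_two, det_fin_two]
    ring
  rw [this]
  exact mul_ne_zero hF hpq

theorem add_smul_rankOne_real (x y t u v : ℝ) :
    !![(x : ℂ), 0; 0, (y : ℂ)] + (t : ℂ) • rankOne ![(u : ℂ), (v : ℂ)] =
      !![((x + t * u ^ 2 : ℝ) : ℂ), ((t * u * v : ℝ) : ℂ);
        ((t * u * v : ℝ) : ℂ), ((y + t * v ^ 2 : ℝ) : ℂ)] := by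
  ext i j
  rw [Matrix.add_apply, Matrix.smul_apply, rankOne, vecMulVec_apply]
  fin_cases i <;> fin_cases j <;> simp [-mul_eq_mul_left_iff] <;> ring

theorem mem_matIcc_of_real_entries {A B F : Mat2} (hB : B - A = F * Fᴴ) {a b d : ℝ} (ha : 0 ≤ a)
    (ha' : a ≤ 1) (hd : 0 ≤ d) (hd' : d ≤ 1) (h : b ^ 2 ≤ a * d)
    (h' : b ^ 2 ≤ (1 - a) * (1 - d)) :
    A + F * !![(a : ℂ), (b : ℂ); (b : ℂ), (d : ℂ)] * Fᴴ ∈ matIcc A B := by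
  refine ⟨?_, ?_⟩
  · rw [add_sub_cancel_left]
    exact (posSemidef_of_real_entries ha hd h).mul_mul_conjTranspose_same F
  · have key : B - (A + F * !![(a : ℂ), (b : ℂ); (b : ℂ), (d : ℂ)] * Fᴴ) =
        F * !![((1 - a : ℝ) : ℂ), ((-b : ℝ) : ℂ); ((-b : ℝ) : ℂ), ((1 - d : ℝ) : ℂ)] * Fᴴ := by
      have : (!![((1 - a : ℝ) : ℂ), ((-b : ℝ) : ℂ); ((-b : ℝ) : ℂ), ((1 - d : ℝ) : ℂ)] : Mat2) =
          1 - !![(a : ℂ), (b : ℂ); (b : ℂ), (d : ℂ)] := by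
        ext i j
        fin_cases i <;> fin_cases j <;> simp
      rw [this, mul_sub, sub_mul, mul_one, ← hB]
      abel
    rw [key]
    refine (posSemidef_of_real_entries (by linarith) (by linarith) ?_).mul_mul_conjTranspose_same F
    simpa using h'

theorem det_mul_mul_conjTranspose (F M : Mat2) :
    (F * M * Fᴴ).det = (Complex.normSq F.det : ℂ) * M.det := by
  rw [det_mul, det_mul, det_conjTranspose, Complex.normSq_eq_conj_mul_self, RCLike.star_def]
  ring

theorem mem_of_det_sub_neg {A B C : Mat2} {S : Set Mat2} (hAB : (B - A).PosDef)
    (hS : LightClosed A C S) (hsub : matIcc A B ⊆ S) {X : Mat2} (hX : X ∈ matIcc A C)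
    (hA : (X - A).det ≠ 0) (hB : (X - B).det.re < 0) : X ∈ S := by
  obtain ⟨F, x, y, hF, hyx, hBF, hXF⟩ := exists_simultaneous_diagonalization hAB hX.1.isHermitian
  have hFu : IsUnit F := (isUnit_iff_isUnit_det _).2 hF.isUnit
  have hX1 := hX.1
  rw [hXF] at hX1
  have hpsd := (IsUnit.posSemidef_star_right_conjugate_iff hFu).1 hX1
  have hy0 : 0 ≤ y := by simpa using hpsd.diag_nonneg (i := 1)
  have hy : 0 < y := by
    refine hy0.lt_of_ne fun h0 => hA ?_
    rw [hXF, det_mul_mul_conjTranspose]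
    simp [← h0]
  have hprod : (x - 1) * (y - 1) < 0 := by
    have e : X - B = F * !![((x - 1 : ℝ) : ℂ), 0; 0, ((y - 1 : ℝ) : ℂ)] * Fᴴ := by
      have : (!![((x - 1 : ℝ) : ℂ), 0; 0, ((y - 1 : ℝ) : ℂ)] : Mat2) =
          !![(x : ℂ), 0; 0, (y : ℂ)] - 1 := by
        ext i j
        fin_cases i <;> fin_cases j <;> simp
      rw [this, mul_sub, sub_mul, mul_one, ← hBF, ← hXF]
      abel
    rw [e, det_mul_mul_conjTranspose, det_fin_two_of, mul_zero, sub_zero, ← Complex.ofReal_mul,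
      ← Complex.ofReal_mul, Complex.ofReal_re] at hB
    exact neg_of_mul_neg_right hB (Complex.normSq_nonneg _)
  have hx1 : 1 < x := by nlinarith
  have hy1 : y < 1 := by nlinarith
  have hXe : X = A + F * !![(x : ℂ), 0; 0, (y : ℂ)] * Fᴴ := by rw [← hXF]; abel
  have hx0 : 0 < x := by linarith
  set η : ℝ := y * (1 - y) / 4 with hη
  have hη0 : 0 < η := by
    have : 0 < 1 - y := by linarith
    positivity
  set ε : ℝ := √η / x with hε
  have hε0 : ε ≠ 0 := by positivity
  have hε2 : x ^ 2 * ε ^ 2 = η := by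
    rw [hε, div_pow, Real.sq_sqrt hη0.le]
    field_simp
  have hε1 : x * ε ^ 2 ≤ η := by
    rw [← hε2]
    nlinarith [sq_nonneg ε, mul_nonneg (mul_nonneg hx0.le (sub_nonneg.2 hx1.le)) (sq_nonneg ε)]
  have tilted : ∀ a : ℝ, 1 / 3 ≤ a → a ≤ 2 / 3 →
      A + F * (!![(x : ℂ), 0; 0, (y : ℂ)] +
        ((a - x : ℝ) : ℂ) • rankOne ![((1 : ℝ) : ℂ), (ε : ℂ)]) * Fᴴ ∈ S := by
    intro a ha ha'
    rw [add_smul_rankOne_real]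
    have hb : ((a - x) * 1 * ε) ^ 2 ≤ η := by
      rw [← hε2]
      have : (a - x) ^ 2 ≤ x ^ 2 := by nlinarith
      nlinarith [sq_nonneg ε]
    have hlow : -η ≤ (a - x) * ε ^ 2 := by nlinarith [sq_nonneg ε]
    have hupp : (a - x) * ε ^ 2 ≤ 0 := by nlinarith [sq_nonneg ε]
    have hηy : 4 * η ≤ y := by nlinarith
    have hηy' : 4 * η ≤ 1 - y := by nlinarith
    refine hsub (mem_matIcc_of_real_entries hBF ?_ ?_ ?_ ?_ (hb.trans ?_) (hb.trans ?_))
    · linarith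
    · linarith
    · linarith
    · linarith
    · nlinarith
    · nlinarith
  have straight : ∀ a : ℝ, 0 ≤ a → a ≤ 1 →
      A + F * (!![(x : ℂ), 0; 0, (y : ℂ)] +
        ((a - x : ℝ) : ℂ) • rankOne ![((1 : ℝ) : ℂ), ((0 : ℝ) : ℂ)]) * Fᴴ ∈ S := by
    intro a ha ha'
    rw [add_smul_rankOne_real]
    refine hsub (mem_matIcc_of_real_entries hBF ?_ ?_ ?_ ?_ ?_ ?_)
    · linarith
    · linarith
    · linarith
    · linarith
    · nlinarith
    · nlinarith
  rw [hXe] at hX ⊢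
  refine hS.mem_congr hF hX _ _ ?_ ?_ ?_ (straight 0 (by norm_num) (by norm_num))
    (straight 1 (by norm_num) (by norm_num)) (tilted (1 / 3) (by norm_num) (by norm_num))
    (tilted (2 / 3) (by norm_num) (by norm_num))
  · simpa using hε0
  · intro h
    linarith
  · intro h
    linarith

theorem mem_of_det_congr_neg {A B C F : Mat2} {S : Set Mat2} (hAB : (B - A).PosDef)
    (hS : LightClosed A C S) (hsub : matIcc A B ⊆ S) (hF : F.det ≠ 0) (hBF : B - A = F * Fᴴ)
    {a b d : ℝ} (hX : A + F * !![(a : ℂ), (b : ℂ); (b : ℂ), (d : ℂ)] * Fᴴ ∈ matIcc A C)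
    (h : 0 < a * d - b ^ 2) (h' : (a - 1) * (d - 1) - b ^ 2 < 0) :
    A + F * !![(a : ℂ), (b : ℂ); (b : ℂ), (d : ℂ)] * Fᴴ ∈ S := by
  have hN : 0 < Complex.normSq F.det := Complex.normSq_pos.2 hF
  refine mem_of_det_sub_neg hAB hS hsub hX ?_ ?_
  · rw [add_sub_cancel_left, det_mul_mul_conjTranspose, det_fin_two_of]
    refine mul_ne_zero (by exact_mod_cast hN.ne') ?_
    rw [← sq]
    exact_mod_cast h.ne'
  · have e : A + F * !![(a : ℂ), (b : ℂ); (b : ℂ), (d : ℂ)] * Fᴴ - B =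
        F * !![((a - 1 : ℝ) : ℂ), (b : ℂ); (b : ℂ), ((d - 1 : ℝ) : ℂ)] * Fᴴ := by
      have : (!![((a - 1 : ℝ) : ℂ), (b : ℂ); (b : ℂ), ((d - 1 : ℝ) : ℂ)] : Mat2) =
          !![(a : ℂ), (b : ℂ); (b : ℂ), (d : ℂ)] - 1 := by
        ext i j
        fin_cases i <;> fin_cases j <;> simp
      rw [this, mul_sub, sub_mul, mul_one, ← hBF]
      abel
    rw [e, det_mul_mul_conjTranspose, det_fin_two_of, ← Complex.ofReal_mul, ← Complex.ofReal_mul,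
      ← Complex.ofReal_sub, ← Complex.ofReal_mul, Complex.ofReal_re]
    exact mul_neg_of_pos_of_neg hN (by linarith)

theorem mem_of_det_sub_ne_zero {A B C : Mat2} {S : Set Mat2} (hAB : (B - A).PosDef)
    (hS : LightClosed A C S) (hsub : matIcc A B ⊆ S) {X : Mat2} (hX : X ∈ matIcc A C)
    (hA : (X - A).det ≠ 0) : X ∈ S := by
  obtain ⟨F, x, y, hF, hyx, hBF, hXF⟩ := exists_simultaneous_diagonalization hAB hX.1.isHermitian
  have hFu : IsUnit F := (isUnit_iff_isUnit_det _).2 hF.isUnit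
  have hX1 := hX.1
  rw [hXF] at hX1
  have hpsd := (IsUnit.posSemidef_star_right_conjugate_iff hFu).1 hX1
  have hy0 : 0 ≤ y := by simpa using hpsd.diag_nonneg (i := 1)
  have hy : 0 < y := by
    refine hy0.lt_of_ne fun h0 => hA ?_
    rw [hXF, det_mul_mul_conjTranspose]
    simp [← h0]
  have hXe : X = A + F * !![(x : ℂ), 0; 0, (y : ℂ)] * Fᴴ := by rw [← hXF]; abel
  rw [hXe] at hX ⊢
  rcases le_or_gt x 1 with hx1 | hx1
  · have := hsub (mem_matIcc_of_real_entries hBF (a := x) (b := 0) (d := y) (by linarith) hx1 hy0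
      (by linarith) (by nlinarith) (by nlinarith))
    simpa using this
  have below : ∀ t u v : ℝ, t ≤ 0 → 0 < x + t * u ^ 2 → 0 < y + t * v ^ 2 →
      0 < (x + t * u ^ 2) * (y + t * v ^ 2) - (t * u * v) ^ 2 →
      (x + t * u ^ 2 - 1) * (y + t * v ^ 2 - 1) - (t * u * v) ^ 2 < 0 →
      A + F * (!![(x : ℂ), 0; 0, (y : ℂ)] + (t : ℂ) • rankOne ![(u : ℂ), (v : ℂ)]) * Fᴴ ∈ S := by
    intro t u v ht h₁ h₂ h₃ h₄
    have hC : A + F * (!![(x : ℂ), 0; 0, (y : ℂ)] +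
        (t : ℂ) • rankOne ![(u : ℂ), (v : ℂ)]) * Fᴴ ∈ matIcc A C := by
      refine ⟨?_, ?_⟩
      · rw [add_sub_cancel_left, add_smul_rankOne_real]
        exact (posSemidef_of_real_entries h₁.le h₂.le (by linarith)).mul_mul_conjTranspose_same F
      · have hdown : (((-t : ℝ) : ℂ) • rankOne (F *ᵥ ![(u : ℂ), (v : ℂ)])).PosSemidef :=
          (posSemidef_vecMulVec_self_star _).smul (Complex.zero_le_real.2 (by linarith))
        convert hX.2.add hdown using 1
        rw [mul_add, add_mul, mul_smul_rankOne_mul, Complex.ofReal_neg, neg_smul]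
        abel
    rw [add_smul_rankOne_real] at hC ⊢
    exact mem_of_det_congr_neg hAB hS hsub hF hBF hC h₃ h₄
  rcases lt_trichotomy y 1 with hy1 | rfl | hy1
  · have := below 0 0 0 le_rfl (by linarith) (by linarith) (by nlinarith) (by nlinarith)
    rwa [Complex.ofReal_zero, zero_smul, add_zero] at this
  · have straight : ∀ a : ℝ, 0 ≤ a → a ≤ 1 →
        A + F * (!![(x : ℂ), 0; 0, ((1 : ℝ) : ℂ)] +
          ((a - x : ℝ) : ℂ) • rankOne ![((1 : ℝ) : ℂ), ((0 : ℝ) : ℂ)]) * Fᴴ ∈ S := by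
      intro a ha ha'
      rw [add_smul_rankOne_real]
      exact hsub (mem_matIcc_of_real_entries hBF (by linarith) (by linarith) (by linarith)
        (by linarith) (by nlinarith) (by nlinarith))
    have tilted : ∀ a : ℝ, 0 < a → a ≤ 1 / 3 →
        A + F * (!![(x : ℂ), 0; 0, ((1 : ℝ) : ℂ)] +
          ((-a : ℝ) : ℂ) • rankOne ![((1 : ℝ) : ℂ), ((1 : ℝ) : ℂ)]) * Fᴴ ∈ S := fun a ha ha' =>
      below _ _ _ (by linarith) (by linarith) (by linarith) (by nlinarith) (by nlinarith)
    refine hS.mem_congr hF hX _ _ ?_ ?_ ?_ (straight 0 (by norm_num) (by norm_num))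
      (straight 1 (by norm_num) (by norm_num)) (tilted (1 / 3) (by norm_num) (by norm_num))
      (tilted (1 / 4) (by norm_num) (by norm_num))
    · simp
    · intro h
      linarith
    · norm_num
  · have horizontal : ∀ a : ℝ, 0 < a → a < 1 →
        A + F * (!![(x : ℂ), 0; 0, (y : ℂ)] +
          ((a - x : ℝ) : ℂ) • rankOne ![((1 : ℝ) : ℂ), ((0 : ℝ) : ℂ)]) * Fᴴ ∈ S := fun a ha ha' =>
      below _ _ _ (by linarith) (by linarith) (by linarith) (by nlinarith) (by nlinarith)
    have vertical : ∀ a : ℝ, 0 < a → a < 1 →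
        A + F * (!![(x : ℂ), 0; 0, (y : ℂ)] +
          ((a - y : ℝ) : ℂ) • rankOne ![((0 : ℝ) : ℂ), ((1 : ℝ) : ℂ)]) * Fᴴ ∈ S := fun a ha ha' =>
      below _ _ _ (by linarith) (by linarith) (by linarith) (by nlinarith) (by nlinarith)
    refine hS.mem_congr hF hX _ _ ?_ ?_ ?_ (horizontal (1 / 2) (by norm_num) (by norm_num))
      (horizontal (1 / 3) (by norm_num) (by norm_num)) (vertical (1 / 2) (by norm_num) (by norm_num))
      (vertical (1 / 3) (by norm_num) (by norm_num))
    · simp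
    · intro h
      linarith
    · intro h
      linarith

/-- Subtracting from a positive semidefinite matrix its Schur rank one part leaves a positive
semidefinite matrix. -/
theorem Matrix.PosSemidef.sub_rankOne {W : Mat2} (hW : W.PosSemidef) (hd : 0 < (W 1 1).re) :
    (W - rankOne ![W 0 1 / (√(W 1 1).re : ℂ), (√(W 1 1).re : ℂ)]).PosSemidef := by
  set r : ℝ := √(W 1 1).re with hr
  have hr0 : (r : ℂ) ≠ 0 := by exact_mod_cast (Real.sqrt_pos.2 hd).ne'
  have h11 : W 1 1 = (r : ℂ) * r := by
    have him : (W 1 1).im = 0 := ((Complex.le_def.1 (hW.diag_nonneg (i := 1))).2).symm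
    apply Complex.ext
    · rw [← Complex.ofReal_mul, Complex.ofReal_re, hr, Real.mul_self_sqrt hd.le]
    · rw [← Complex.ofReal_mul, Complex.ofReal_im, him]
  have h10 : W 1 0 = star (W 0 1) := (hW.isHermitian.apply 1 0).symm
  have hdet := hW.det_nonneg
  have hdiag : W - rankOne ![W 0 1 / (r : ℂ), (r : ℂ)] = diagonal ![W.det / (r * r : ℂ), 0] := by
    ext i j
    rw [Matrix.sub_apply, rankOne, vecMulVec_apply, det_fin_two]
    fin_cases i <;> fin_cases j <;> simp [h11, h10] <;> field_simp <;> simp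
  rw [hdiag, posSemidef_diagonal_iff]
  intro i
  fin_cases i
  · have : (0 : ℂ) ≤ ((r * r)⁻¹ : ℝ) := Complex.zero_le_real.2 (by positivity)
    simpa [div_eq_mul_inv] using mul_nonneg hdet this
  · simp

theorem LightClosed.matIcc_subset {A B C : Mat2} {S : Set Mat2} (hAB : (B - A).PosDef)
    (hAC : (C - A).PosDef) (hS : LightClosed A C S) (hsub : matIcc A B ⊆ S) :
    matIcc A C ⊆ S := by
  intro X hX
  by_cases hA : (X - A).det = 0
  swap
  · exact mem_of_det_sub_ne_zero hAB hS hsub hX hA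
  obtain ⟨F, x, y, hF, hyx, hBF, hXF⟩ := exists_simultaneous_diagonalization hAB hX.1.isHermitian
  have hFu : IsUnit F := (isUnit_iff_isUnit_det _).2 hF.isUnit
  have hN : (Complex.normSq F.det : ℂ) ≠ 0 := by exact_mod_cast (Complex.normSq_pos.2 hF).ne'
  have hX1 := hX.1
  rw [hXF] at hX1
  have hpsd := (IsUnit.posSemidef_star_right_conjugate_iff hFu).1 hX1
  have hy0 : 0 ≤ y := by simpa using hpsd.diag_nonneg (i := 1)
  have hxy : x * y = 0 := by
    rw [hXF, det_mul_mul_conjTranspose, det_fin_two_of, mul_zero, sub_zero] at hA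
    exact_mod_cast (mul_eq_zero.1 hA).resolve_left hN
  obtain rfl : y = 0 := by nlinarith
  have hXe : X = A + F * !![(x : ℂ), 0; 0, ((0 : ℝ) : ℂ)] * Fᴴ := by rw [← hXF]; abel
  rcases hyx.eq_or_lt with rfl | hx
  · rw [hXe]
    simpa using hsub (mem_matIcc_of_real_entries hBF (a := 0) (b := 0) (d := 0) le_rfl zero_le_one
      le_rfl zero_le_one (by norm_num) (by norm_num))
  set W : Mat2 := F⁻¹ * (C - X) * F⁻¹ᴴ with hWdef
  have hW : W.PosSemidef := hX.2.mul_mul_conjTranspose_same _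
  have hFd : IsUnit F.det := hF.isUnit
  have hinv : F⁻¹ᴴ * Fᴴ = 1 := by
    rw [← conjTranspose_mul, mul_nonsing_inv _ hFd, conjTranspose_one]
  have hCW : C - X = F * W * Fᴴ := by
    calc C - X = (F * F⁻¹) * (C - X) * (F⁻¹ᴴ * Fᴴ) := by
          rw [mul_nonsing_inv _ hFd, hinv, one_mul, mul_one]
      _ = _ := by rw [hWdef]; simp only [mul_assoc]
  have hd : 0 < (W 1 1).re := by
    have hsum : C - A = F * (!![(x : ℂ), 0; 0, ((0 : ℝ) : ℂ)] + W) * Fᴴ := by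
      rw [mul_add, add_mul, ← hXF, ← hCW]
      abel
    rw [hsum] at hAC
    have := ((IsUnit.posDef_star_right_conjugate_iff hFu).1 hAC).diag_pos (i := 1)
    simpa using (Complex.lt_def.1 this).1
  have hr0 : (√(W 1 1).re : ℂ) ≠ 0 := by exact_mod_cast (Real.sqrt_pos.2 hd).ne'
  set q : Fin 2 → ℂ := ![W 0 1 / (√(W 1 1).re : ℂ), (√(W 1 1).re : ℂ)] with hq
  have hWq : (W - rankOne q).PosSemidef := hW.sub_rankOne hd
  have upward : ∀ s : ℝ, 0 < s → s ≤ 1 →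
      A + F * (!![(x : ℂ), 0; 0, ((0 : ℝ) : ℂ)] + (s : ℂ) • rankOne q) * Fᴴ ∈ S := by
    intro s hs hs1
    refine mem_of_det_sub_ne_zero hAB hS hsub ⟨?_, ?_⟩ ?_
    · rw [add_sub_cancel_left]
      exact (hpsd.add ((posSemidef_vecMulVec_self_star q).smul
        (Complex.zero_le_real.2 hs.le))).mul_mul_conjTranspose_same F
    · have e : C - (A + F * (!![(x : ℂ), 0; 0, ((0 : ℝ) : ℂ)] + (s : ℂ) • rankOne q) * Fᴴ) =
          F * ((W - rankOne q) + ((1 - s : ℝ) : ℂ) • rankOne q) * Fᴴ := by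
        have : (W - rankOne q) + ((1 - s : ℝ) : ℂ) • rankOne q = W - (s : ℂ) • rankOne q := by
          rw [Complex.ofReal_sub, Complex.ofReal_one, sub_smul, one_smul]
          abel
        rw [this, mul_sub, sub_mul, mul_add, add_mul, ← hXF, ← hCW]
        abel
      rw [e]
      exact (hWq.add ((posSemidef_vecMulVec_self_star q).smul
        (Complex.zero_le_real.2 (by linarith)))).mul_mul_conjTranspose_same F
    · rw [add_sub_cancel_left, det_mul_mul_conjTranspose]
      refine mul_ne_zero hN ?_
      have e : (!![(x : ℂ), 0; 0, ((0 : ℝ) : ℂ)] + (s : ℂ) • rankOne q).det =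
          x * s * (q 1 * star (q 1)) := by
        rw [det_fin_two]
        simp only [Matrix.add_apply, Matrix.smul_apply, rankOne, vecMulVec_apply, Pi.star_apply]
        simp
        ring
      rw [e]
      have hq1 : q 1 ≠ 0 := by simpa [hq] using hr0
      exact mul_ne_zero (mul_ne_zero (by exact_mod_cast hx.ne') (by exact_mod_cast hs.ne'))
        (mul_ne_zero hq1 (star_ne_zero.2 hq1))
  have straight : ∀ a : ℝ, 0 ≤ a → a ≤ 1 →
      A + F * (!![(x : ℂ), 0; 0, ((0 : ℝ) : ℂ)] +
        ((a - x : ℝ) : ℂ) • rankOne ![((1 : ℝ) : ℂ), ((0 : ℝ) : ℂ)]) * Fᴴ ∈ S := by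
    intro a ha ha'
    rw [add_smul_rankOne_real]
    exact hsub (mem_matIcc_of_real_entries hBF (by linarith) (by linarith) (by linarith)
      (by linarith) (by nlinarith) (by nlinarith))
  rw [hXe] at hX ⊢
  refine hS.mem_congr hF hX _ _ ?_ ?_ ?_ (straight 0 le_rfl zero_le_one)
    (straight 1 zero_le_one le_rfl) (upward (1 / 2) (by norm_num) (by norm_num))
    (upward 1 one_pos le_rfl)
  · simpa [hq] using hr0
  · intro h
    linarith
  · norm_num

theorem lightClosed_setOf_eq_cayley {A C : Mat2} (hA : A.IsHermitian) {φ : Mat2 → U2}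
    (hφ : ∀ X ∈ matIcc A C, ∀ Y ∈ matIcc A C, Coherent X Y → CoherentU (φ X) (φ Y)) :
    LightClosed A C {X | X ∈ matIcc A C ∧ φ X = cayley X} := by
  intro X hX p q hpq t₁ t₂ s₁ s₂ ht hs h₁ h₂ h₃ h₄
  have hXH : X.IsHermitian := by simpa using hX.1.isHermitian.add hA
  have coh : ∀ (t : ℝ) (v : Fin 2 → ℂ),
      X + (t : ℂ) • rankOne v ∈ {X | X ∈ matIcc A C ∧ φ X = cayley X} →
      CoherentU (φ X) (cayley (X + (t : ℂ) • rankOne v)) := by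
    rintro t v ⟨hmem, heq⟩
    rw [← heq]
    refine hφ X hX _ hmem ?_
    have e : X - (X + (t : ℂ) • rankOne v) = vecMulVec (-(t : ℂ) • v) (star v) := by
      rw [smul_vecMulVec, neg_smul]
      abel
    rw [Coherent, e]
    exact rank_vecMulVec_le _ _
  exact ⟨hX, eq_cayley_of_coherentU hXH hpq ht hs (coh _ _ h₁) (coh _ _ h₂) (coh _ _ h₃)
    (coh _ _ h₄)⟩

/-- A coherency preserver on `[A, C]` (with `A < B < C`) which is the Cayley embedding on
`[A, B]` is the Cayley embedding on all of `[A, C]`. -/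
theorem coherency_preserver_identity_on_subinterval
    (A B C : Mat2) (hA : A.IsHermitian)
    (hAB : (B - A).PosDef) (hBC : (C - B).PosDef)
    (φ : Mat2 → U2)
    (hφ : ∀ X ∈ matIcc A C, ∀ Y ∈ matIcc A C, Coherent X Y → CoherentU (φ X) (φ Y))
    (hid : ∀ X ∈ matIcc A B, φ X = cayley X) :
    ∀ X ∈ matIcc A C, φ X = cayley X := by
  intro X hX
  have hAC : (C - A).PosDef := by simpa using hBC.add hAB
  refine ((lightClosed_setOf_eq_cayley hA hφ).matIcc_subset hAB hAC ?_ hX).2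
  refine fun Y hY => ⟨⟨hY.1, ?_⟩, hid Y hY⟩
  simpa using hBC.posSemidef.add hY.2
end
end

section
/- Let A, B ∈ H₂ with A < B. If U ∈ U₂ satisfies rank(U − 𝔠(A)) ≤ 1 and rank(U − 𝔠(B)) ≤ 1, then there exists X ∈ H₂ with A ≤ X ≤ B and U = 𝔠(X). (In other words, the set 𝒮_{A,B} of points of the compactification coherent to both A and B is contained in the matrix interval [A,B], and in particular in H₂.) -/
open Matrix
open scoped ComplexOrder

noncomputable section

theorem det_eq_zero_of_rank_le_one {M : Mat2} (h : M.rank ≤ 1) : M.det = 0 := by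
  by_contra hd
  have := Matrix.rank_of_isUnit M ((Matrix.isUnit_iff_isUnit_det M).2 (isUnit_iff_ne_zero.2 hd))
  simp at this
  omega

theorem isUnit_add_I_smul_one {A : Mat2} (hA : A.IsHermitian) :
    IsUnit (A + Complex.I • (1 : Mat2)) := by
  have hpos : (A * A + 1).PosDef := by
    have h := Matrix.posSemidef_conjTranspose_mul_self A
    rw [hA.eq] at h
    exact Matrix.PosDef.posSemidef_add h Matrix.PosDef.one
  have hfac : (A - Complex.I • (1 : Mat2)) * (A + Complex.I • (1 : Mat2)) = A * A + 1 := by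
    simp [sub_mul, mul_add, smul_sub, smul_smul]
    abel
  have hu := hpos.isUnit
  rw [← hfac, Matrix.isUnit_iff_isUnit_det, Matrix.det_mul] at hu
  exact (Matrix.isUnit_iff_isUnit_det _).2 (isUnit_of_mul_isUnit_right hu)

theorem conjTranspose_add_I_smul_one {A : Mat2} (hA : A.IsHermitian) :
    (A + Complex.I • (1 : Mat2))ᴴ = A - Complex.I • (1 : Mat2) := by
  simp [Matrix.conjTranspose_add, Matrix.conjTranspose_smul, hA.eq, sub_eq_add_neg]

theorem conjTranspose_sub_I_smul_one {A : Mat2} (hA : A.IsHermitian) :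
    (A - Complex.I • (1 : Mat2))ᴴ = A + Complex.I • (1 : Mat2) := by
  rw [← conjTranspose_add_I_smul_one hA, Matrix.conjTranspose_conjTranspose]

theorem cayleyMat_mem_unitaryGroup_s13 {A : Mat2} (hA : A.IsHermitian) :
    cayleyMat A ∈ Matrix.unitaryGroup (Fin 2) ℂ := by
  have hN := isUnit_add_I_smul_one hA
  have hNdet := (Matrix.isUnit_iff_isUnit_det _).1 hN
  have hMdet : IsUnit (A - Complex.I • (1 : Mat2)).det := by
    rw [← conjTranspose_add_I_smul_one hA, Matrix.det_conjTranspose]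
    exact hNdet.star
  have hcomm : (A + Complex.I • (1 : Mat2)) * (A - Complex.I • (1 : Mat2)) =
      (A - Complex.I • (1 : Mat2)) * (A + Complex.I • (1 : Mat2)) := by
    simp [sub_mul, mul_add, mul_sub, add_mul, smul_sub, smul_smul]
    abel
  rw [Matrix.mem_unitaryGroup_iff', Matrix.star_eq_conjTranspose, cayleyMat,
    Matrix.conjTranspose_mul, Matrix.conjTranspose_nonsing_inv,
    conjTranspose_add_I_smul_one hA, conjTranspose_sub_I_smul_one hA, Matrix.mul_assoc,
    ← Matrix.mul_assoc (A + _), hcomm, Matrix.mul_assoc, Matrix.mul_nonsing_inv _ hNdet,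
    Matrix.mul_one, Matrix.nonsing_inv_mul _ hMdet]

theorem coe_cayley_s13 {A : Mat2} (hA : A.IsHermitian) : (cayley A : Mat2) = cayleyMat A := by
  simp [cayley, cayleyMat_mem_unitaryGroup_s13 hA]

/-- A unitary coherent to `𝔠(A)` satisfies `(1 - U) A x = i (1 + U) x` for some `x ≠ 0`. -/
theorem exists_mulVec_eq_zero_of_coherentU_cayley {A : Mat2} (hA : A.IsHermitian) {U : U2}
    (h : CoherentU U (cayley A)) :
    ∃ x : Fin 2 → ℂ, x ≠ 0 ∧
      (Complex.I • (1 + (U : Mat2)) - (1 - (U : Mat2)) * A) *ᵥ x = 0 := by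
  have hdet := det_eq_zero_of_rank_le_one h
  rw [coe_cayley_s13 hA] at hdet
  have hN := (Matrix.isUnit_iff_isUnit_det _).1 (isUnit_add_I_smul_one hA)
  apply Matrix.exists_mulVec_eq_zero_iff.2
  have hfac : Complex.I • (1 + (U : Mat2)) - (1 - (U : Mat2)) * A =
      ((U : Mat2) - cayleyMat A) * (A + Complex.I • (1 : Mat2)) := by
    rw [sub_mul (U : Mat2), cayleyMat, Matrix.mul_assoc, Matrix.nonsing_inv_mul _ hN]
    simp [sub_mul, mul_add]
    abel
  rw [hfac, Matrix.det_mul, hdet, zero_mul]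

/-- A left fixed vector of `U` annihilates every solution of `(1 - U) A x = i (1 + U) x`. -/
theorem dotProduct_eq_zero_of_vecMul_eq_zero {A U : Mat2} {w x : Fin 2 → ℂ}
    (hw : w ᵥ* (1 - U) = 0)
    (hx : (Complex.I • (1 + U) - (1 - U) * A) *ᵥ x = 0) : w ⬝ᵥ x = 0 := by
  have hU : w ᵥ* U = w := by
    rw [Matrix.vecMul_sub, Matrix.vecMul_one, sub_eq_zero] at hw
    exact hw.symm
  have h := congrArg (w ⬝ᵥ ·) hx
  simp only [Matrix.dotProduct_mulVec, Matrix.vecMul_sub, ← Matrix.vecMul_vecMul, hw,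
    Matrix.vecMul_smul, Matrix.vecMul_add, Matrix.vecMul_one, hU, Matrix.zero_vecMul, sub_zero,
    dotProduct_zero, smul_dotProduct, add_dotProduct, smul_eq_mul, mul_eq_zero,
    Complex.I_ne_zero, false_or] at h
  simpa [← two_mul] using h

theorem exists_smul_eq_of_dotProduct_eq_zero {w x y : Fin 2 → ℂ} (hw : w ≠ 0) (hx : x ≠ 0)
    (hwx : w ⬝ᵥ x = 0) (hwy : w ⬝ᵥ y = 0) : ∃ c : ℂ, y = c • x := by
  have hdet : (!![x 0, x 1; y 0, y 1] : Mat2).det = 0 := by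
    refine Matrix.exists_mulVec_eq_zero_iff.1 ⟨w, hw, ?_⟩
    simp only [dotProduct, Fin.sum_univ_two] at hwx hwy
    ext i
    fin_cases i
    · simp [Matrix.mulVec, dotProduct, Fin.sum_univ_two]; linear_combination hwx
    · simp [Matrix.mulVec, dotProduct, Fin.sum_univ_two]; linear_combination hwy
  rw [Matrix.det_fin_two_of] at hdet
  by_cases h0 : x 0 = 0
  · have h1 : x 1 ≠ 0 := fun h1 => hx (by ext i; fin_cases i <;> simp [h0, h1])
    refine ⟨y 1 / x 1, ?_⟩
    ext i
    fin_cases i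
    · have : y 0 = 0 := by simpa [h0, h1] using hdet
      simp [h0, this]
    · simp [h1]
  · refine ⟨y 0 / x 0, ?_⟩
    ext i
    fin_cases i
    · simp [h0]
    · simp only [Fin.mk_one, Pi.smul_apply, smul_eq_mul]
      field_simp
      linear_combination hdet

theorem isUnit_one_sub_of_coherentU {A B : Mat2} (hA : A.IsHermitian) (hAB : (B - A).PosDef)
    {U : U2} (hUA : CoherentU U (cayley A)) (hUB : CoherentU U (cayley B)) :
    IsUnit (1 - (U : Mat2)) := by
  have hB : B.IsHermitian := by simpa using hAB.isHermitian.add hA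
  obtain ⟨x, hx0, hx⟩ := exists_mulVec_eq_zero_of_coherentU_cayley hA hUA
  obtain ⟨y, hy0, hy⟩ := exists_mulVec_eq_zero_of_coherentU_cayley hB hUB
  rw [Matrix.isUnit_iff_isUnit_det, isUnit_iff_ne_zero]
  intro hdet
  obtain ⟨w, hw0, hw⟩ := Matrix.exists_vecMul_eq_zero_iff.2 hdet
  obtain ⟨c, rfl⟩ := exists_smul_eq_of_dotProduct_eq_zero hw0 hx0
    (dotProduct_eq_zero_of_vecMul_eq_zero hw hx) (dotProduct_eq_zero_of_vecMul_eq_zero hw hy)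
  have hc : c ≠ 0 := fun h => hy0 (by simp [h])
  rw [Matrix.mulVec_smul, smul_eq_zero_iff_right hc] at hy
  have hz : (1 - (U : Mat2)) *ᵥ ((B - A) *ᵥ x) = 0 := by
    have h : (1 - (U : Mat2)) * (B - A) = (Complex.I • (1 + (U : Mat2)) - (1 - (U : Mat2)) * A) -
        (Complex.I • (1 + (U : Mat2)) - (1 - (U : Mat2)) * B) := by
      rw [mul_sub]; abel
    rw [Matrix.mulVec_mulVec, h, Matrix.sub_mulVec, hx, hy, sub_zero]
  have hzU : star ((B - A) *ᵥ x) ᵥ* (1 - (U : Mat2)) = 0 := by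
    have hUU : (U : Mat2)ᴴ * (U : Mat2) = 1 := Matrix.mem_unitaryGroup_iff'.1 U.2
    have h : ((U : Mat2)ᴴ * (1 - (U : Mat2))) *ᵥ ((B - A) *ᵥ x) = 0 := by
      rw [← Matrix.mulVec_mulVec, hz, Matrix.mulVec_zero]
    have h' : (1 - (U : Mat2)) = -((U : Mat2)ᴴ * (1 - (U : Mat2)))ᴴ := by
      rw [mul_sub, hUU]; simp
    rw [h', Matrix.vecMul_neg, ← Matrix.star_mulVec, h]
    simp
  have h0 := dotProduct_eq_zero_of_vecMul_eq_zero hzU hx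
  rw [Matrix.star_mulVec, hAB.isHermitian.eq, ← Matrix.dotProduct_mulVec] at h0
  exact (hAB.dotProduct_mulVec_pos hx0).ne' h0

/-- The inverse Cayley transform of a unitary without eigenvalue `1`. -/
theorem exists_isHermitian_cayley_eq {U : U2} (hU : IsUnit (1 - (U : Mat2))) :
    ∃ X : Mat2, X.IsHermitian ∧ (1 - (U : Mat2)) * X = Complex.I • (1 + (U : Mat2)) ∧
      U = cayley X := by
  have hdet := (Matrix.isUnit_iff_isUnit_det _).1 hU
  have hUU : (U : Mat2) * (U : Mat2)ᴴ = 1 := Matrix.mem_unitaryGroup_iff.1 U.2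
  obtain ⟨X, hX⟩ : ∃ X : Mat2, X = (1 - (U : Mat2))⁻¹ * (Complex.I • (1 + (U : Mat2))) := ⟨_, rfl⟩
  have hmul : (1 - (U : Mat2)) * X = Complex.I • (1 + (U : Mat2)) := by
    rw [hX, ← Matrix.mul_assoc, Matrix.mul_nonsing_inv _ hdet, Matrix.one_mul]
  have hconj : (1 - (U : Mat2)) * X * (1 - (U : Mat2))ᴴ =
      Complex.I • ((U : Mat2) - (U : Mat2)ᴴ) := by
    rw [hmul]
    simp [mul_sub, add_mul, hUU, smul_sub]
    abel
  have hherm : X.IsHermitian := by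
    have h : (1 - (U : Mat2)) * Xᴴ * (1 - (U : Mat2))ᴴ =
        (1 - (U : Mat2)) * X * (1 - (U : Mat2))ᴴ := by
      have h' := congrArg Matrix.conjTranspose hconj
      rw [Matrix.conjTranspose_mul, Matrix.conjTranspose_mul, Matrix.conjTranspose_conjTranspose,
        ← Matrix.mul_assoc] at h'
      rw [h', hconj, Matrix.conjTranspose_smul, Matrix.conjTranspose_sub,
        Matrix.conjTranspose_conjTranspose, Complex.star_def, Complex.conj_I, neg_smul,
        ← smul_neg, neg_sub]
    have hU' : IsUnit (1 - (U : Mat2))ᴴ := hU.star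
    exact hU.mul_left_cancel (hU'.mul_right_cancel h)
  refine ⟨X, hherm, hmul, ?_⟩
  have hN := (Matrix.isUnit_iff_isUnit_det _).1 (isUnit_add_I_smul_one hherm)
  apply Subtype.ext
  have hfac : (U : Mat2) * (X + Complex.I • (1 : Mat2)) = X - Complex.I • (1 : Mat2) := by
    have h : X - (U : Mat2) * X = Complex.I • (1 + (U : Mat2)) := by rw [← hmul, sub_mul, one_mul]
    rw [smul_add, sub_eq_iff_eq_add] at h
    rw [mul_add, Matrix.mul_smul, Matrix.mul_one, eq_sub_iff_add_eq]
    refine Eq.trans ?_ h.symm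
    abel
  rw [coe_cayley_s13 hherm, cayleyMat, ← hfac, Matrix.mul_assoc, Matrix.mul_nonsing_inv _ hN,
    Matrix.mul_one]

/-- If `D` is positive definite and both `P` and `D - P` are singular hermitian `2×2` matrices,
then `P` is positive semidefinite. -/
theorem posSemidef_of_mulVec_eq_zero {P D : Mat2} (hP : P.IsHermitian) (hD : D.PosDef)
    {x y : Fin 2 → ℂ} (hx0 : x ≠ 0) (hy0 : y ≠ 0) (hx : P *ᵥ x = 0) (hy : (D - P) *ᵥ y = 0) :
    P.PosSemidef := by
  have hPy : P *ᵥ y = D *ᵥ y := by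
    rw [Matrix.sub_mulVec, sub_eq_zero] at hy
    exact hy.symm
  have hxP : star x ᵥ* P = 0 := by
    rw [← hP.eq, ← Matrix.star_mulVec, hx, star_zero]
  have hTdet : (!![x 0, y 0; x 1, y 1] : Mat2).det ≠ 0 := by
    intro hdet
    obtain ⟨w, hw0, hw⟩ := Matrix.exists_vecMul_eq_zero_iff.2 hdet
    have hwx : w ⬝ᵥ x = 0 := by
      simpa [Matrix.vecMul, dotProduct, Fin.sum_univ_two] using congrFun hw 0
    have hwy : w ⬝ᵥ y = 0 := by
      simpa [Matrix.vecMul, dotProduct, Fin.sum_univ_two] using congrFun hw 1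
    obtain ⟨c, rfl⟩ := exists_smul_eq_of_dotProduct_eq_zero hw0 hx0 hwx hwy
    have h := hD.dotProduct_mulVec_pos hy0
    rw [← hPy, Matrix.mulVec_smul, hx] at h
    simp at h
  refine Matrix.PosSemidef.of_dotProduct_mulVec_nonneg hP fun v => ?_
  obtain ⟨a, b, rfl⟩ : ∃ a b : ℂ, v = a • x + b • y := by
    have hv : !![x 0, y 0; x 1, y 1] *ᵥ ((!![x 0, y 0; x 1, y 1] : Mat2)⁻¹ *ᵥ v) = v := by
      rw [Matrix.mulVec_mulVec, Matrix.mul_nonsing_inv _ (isUnit_iff_ne_zero.2 hTdet),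
        Matrix.one_mulVec]
    refine ⟨((!![x 0, y 0; x 1, y 1] : Mat2)⁻¹ *ᵥ v) 0,
      ((!![x 0, y 0; x 1, y 1] : Mat2)⁻¹ *ᵥ v) 1, ?_⟩
    generalize (!![x 0, y 0; x 1, y 1] : Mat2)⁻¹ *ᵥ v = u at hv
    rw [← hv]
    ext i
    fin_cases i <;> simp [Matrix.mulVec, dotProduct, Fin.sum_univ_two] <;> ring
  have hcalc : star (a • x + b • y) ⬝ᵥ P *ᵥ (a • x + b • y) =
      (star b * b) * (star y ⬝ᵥ D *ᵥ y) := by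
    have hxPy : star x ⬝ᵥ D *ᵥ y = 0 := by
      rw [← hPy, Matrix.dotProduct_mulVec, hxP, zero_dotProduct]
    rw [Matrix.mulVec_add, Matrix.mulVec_smul, Matrix.mulVec_smul, hx, hPy, star_add, star_smul,
      star_smul]
    simp only [smul_zero, zero_add, add_dotProduct, smul_dotProduct, dotProduct_smul, hxPy,
      smul_eq_mul, mul_zero]
    ring
  rw [hcalc]
  exact mul_nonneg (star_mul_self_nonneg b) (hD.dotProduct_mulVec_pos hy0).le

/-- For `A < B` in `H₂`, every point of `U₂` coherent to both `𝔠(A)` and `𝔠(B)` is the Cayley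
image of some `X ∈ [A, B]`; in particular `𝒮_{A,B} ⊆ [A,B] ⊆ H₂`. -/
theorem S_AB_subset_interval
    (A B : Mat2) (hA : A.IsHermitian) (hAB : (B - A).PosDef)
    (U : U2) (hUA : CoherentU U (cayley A)) (hUB : CoherentU U (cayley B)) :
    ∃ X : Mat2, (X - A).PosSemidef ∧ (B - X).PosSemidef ∧ U = cayley X := by
  have hB : B.IsHermitian := by simpa using hAB.isHermitian.add hA
  have hunit := isUnit_one_sub_of_coherentU hA hAB hUA hUB
  obtain ⟨X, hX, hmul, hUX⟩ := exists_isHermitian_cayley_eq hunit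
  obtain ⟨x, hx0, hx⟩ := exists_mulVec_eq_zero_of_coherentU_cayley hA hUA
  obtain ⟨y, hy0, hy⟩ := exists_mulVec_eq_zero_of_coherentU_cayley hB hUB
  have hinj := Matrix.mulVec_injective_of_isUnit hunit
  rw [← hmul, ← mul_sub, ← Matrix.mulVec_mulVec] at hx hy
  have hx' : (X - A) *ᵥ x = 0 := hinj (by rw [hx, Matrix.mulVec_zero])
  have hy' : (B - X) *ᵥ y = 0 := by
    rw [← neg_sub, Matrix.neg_mulVec, neg_eq_zero]
    exact hinj (by rw [hy, Matrix.mulVec_zero])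
  refine ⟨X, ?_, ?_, hUX⟩
  · refine posSemidef_of_mulVec_eq_zero (hX.sub hA) hAB hx0 hy0 hx' ?_
    rwa [sub_sub_sub_cancel_right]
  · refine posSemidef_of_mulVec_eq_zero (hB.sub hX) hAB hy0 hx0 hy' ?_
    rwa [sub_sub_sub_cancel_left]
end
end
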